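/- arXiv:2510.24966 — 10 statements merged into one kernel-verified Lean document; each statement's English description precedes it below -/
import Mathlib

section
/- Let L be an n×m real matrix with n ≤ m whose singular values σ_1 ≥ … ≥ σ_n satisfy C_0 · i^{−α} ≤ σ_i ≤ C_1 · i^{−α} for all i ∈ [n], for some constants C_0, C_1 > 0 and exponent 0 < α < 1/2. Then there is an absolute constant c > 0 such that every matrix A of rank at most r with r ≤ n / 2^{1/(1−2α)} satisfies ‖L − A‖_F ≥ c · (C_0/C_1) · ‖L‖_F. -/
open Matrix

/-- Frobenius norm of a real matrix. -/
noncomputable def frobNorm {n m : ℕ} (A : Matrix (Fin n) (Fin m) ℝ) : ℝ :=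
  Real.sqrt (∑ i, ∑ j, (A i j) ^ 2)

lemma mul_rpow_sub_one_le_rpow_add_one_sub {x t : ℝ} (hx : 0 ≤ x) (ht0 : 0 ≤ t) (ht1 : t ≤ 1) :
    t * (x + 1) ^ (t - 1) ≤ (x + 1) ^ t - x ^ t := by
  have hp : 0 < x + 1 := by linarith
  have hb := rpow_one_add_le_one_add_mul_self (s := -(1 / (x + 1))) (p := t)
    (by rw [neg_le_neg_iff, div_le_one hp]; linarith) ht0 ht1
  have hq : 1 + -(1 / (x + 1)) = x / (x + 1) := by field_simp; ring
  rw [hq, Real.div_rpow hx hp.le, div_le_iff₀ (by positivity)] at hb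
  rw [Real.rpow_sub_one hp.ne']
  calc t * ((x + 1) ^ t / (x + 1))
      = (x + 1) ^ t - (1 + t * -(1 / (x + 1))) * (x + 1) ^ t := by ring
    _ ≤ _ := by linarith

lemma rpow_add_one_sub_le_two_mul {x t : ℝ} (hx : 1 ≤ x) (ht0 : 0 ≤ t) (ht1 : t ≤ 1) :
    (x + 1) ^ t - x ^ t ≤ 2 * (t * (x + 1) ^ (t - 1)) := by
  have hp : 0 < x := by linarith
  have hp1 : 0 < x + 1 := by linarith
  have hb := rpow_one_add_le_one_add_mul_self (s := 1 / x) (p := t)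
    (by have : 0 < 1 / x := by positivity
        linarith) ht0 ht1
  have hq : 1 + 1 / x = (x + 1) / x := by field_simp
  rw [hq, Real.div_rpow hp1.le hp.le, div_le_iff₀ (by positivity)] at hb
  have hmono : x ^ t ≤ (x + 1) ^ t := Real.rpow_le_rpow hp.le (by linarith) ht0
  rw [Real.rpow_sub_one hp1.ne']
  calc (x + 1) ^ t - x ^ t ≤ t * (x ^ t / x) := by
        have : (1 + t * (1 / x)) * x ^ t = x ^ t + t * (x ^ t / x) := by ring
        linarith
    _ ≤ t * (2 * ((x + 1) ^ t / (x + 1))) := by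
        gcongr
        rw [div_le_iff₀ hp]
        have h2 : 1 ≤ 2 * x / (x + 1) := by rw [le_div_iff₀ hp1]; linarith
        calc x ^ t ≤ (x + 1) ^ t * 1 := by linarith
          _ ≤ (x + 1) ^ t * (2 * x / (x + 1)) := by gcongr
          _ = _ := by ring
    _ = _ := by ring

/-- A power sum with exponent in `(-1, 0]` is at most three times its tail beyond `r`, as soon as
`2 r ^ t ≤ n ^ t`. -/
lemma sum_range_rpow_le_three_mul_sum_Ico {t : ℝ} (ht0 : 0 < t) (ht1 : t ≤ 1) {n r : ℕ}
    (hrn : r ≤ n) (h : 2 * (r : ℝ) ^ t ≤ (n : ℝ) ^ t) :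
    ∑ i ∈ Finset.range n, ((i : ℝ) + 1) ^ (t - 1) ≤
      3 * ∑ i ∈ Finset.Ico r n, ((i : ℝ) + 1) ^ (t - 1) := by
  have hsplit := Finset.sum_range_add_sum_Ico (fun i : ℕ => ((i : ℝ) + 1) ^ (t - 1)) hrn
  rcases Nat.eq_zero_or_pos r with rfl | hr
  · have : 0 ≤ ∑ i ∈ Finset.Ico 0 n, ((i : ℝ) + 1) ^ (t - 1) :=
      Finset.sum_nonneg fun i _ => by positivity
    simp only [Finset.range_zero, Finset.sum_empty, zero_add] at hsplit
    linarith
  have hhead : t * ∑ i ∈ Finset.range r, ((i : ℝ) + 1) ^ (t - 1) ≤ (r : ℝ) ^ t := by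
    calc t * ∑ i ∈ Finset.range r, ((i : ℝ) + 1) ^ (t - 1)
        ≤ ∑ i ∈ Finset.range r, (((i + 1 : ℕ) : ℝ) ^ t - (i : ℝ) ^ t) := by
          rw [Finset.mul_sum]
          refine Finset.sum_le_sum fun i _ => ?_
          push_cast
          exact mul_rpow_sub_one_le_rpow_add_one_sub (by positivity) ht0.le ht1
      _ = (r : ℝ) ^ t := by
          rw [Finset.sum_range_sub (fun i : ℕ => (i : ℝ) ^ t)]
          simp [Real.zero_rpow ht0.ne']
  have htail : (n : ℝ) ^ t - (r : ℝ) ^ t ≤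
      2 * (t * ∑ i ∈ Finset.Ico r n, ((i : ℝ) + 1) ^ (t - 1)) := by
    rw [← Finset.sum_Ico_sub (fun i : ℕ => (i : ℝ) ^ t) hrn, Finset.mul_sum, Finset.mul_sum]
    refine Finset.sum_le_sum fun i hi => ?_
    have : (1 : ℝ) ≤ i := by exact_mod_cast hr.trans_le (Finset.mem_Ico.1 hi).1
    push_cast
    exact rpow_add_one_sub_le_two_mul this ht0.le ht1
  have : t * ∑ i ∈ Finset.range r, ((i : ℝ) + 1) ^ (t - 1) ≤
      t * (2 * ∑ i ∈ Finset.Ico r n, ((i : ℝ) + 1) ^ (t - 1)) := by linarith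
  have := le_of_mul_le_mul_left this ht0
  linarith

/-- Weights in `[0, 1]` of total mass at least `n - r` put, on an antitone nonnegative sequence,
at least the mass of its tail beyond `r`. -/
lemma Antitone.sum_tail_le_sum_mul {n r : ℕ} {f w : Fin n → ℝ} (hf : Antitone f)
    (hf0 : ∀ i, 0 ≤ f i) (hw0 : ∀ i, 0 ≤ w i) (hw1 : ∀ i, w i ≤ 1)
    (hw : (n : ℝ) - r ≤ ∑ i, w i) :
    ∑ i : Fin n, (if r ≤ (i : ℕ) then f i else 0) ≤ ∑ i, f i * w i := by
  rcases le_or_gt n r with hrn | hrn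
  · rw [Finset.sum_eq_zero fun i _ => if_neg (by have := i.2; omega)]
    exact Finset.sum_nonneg fun i _ => mul_nonneg (hf0 i) (hw0 i)
  have hcard : ∑ i : Fin n, (if r ≤ (i : ℕ) then (1 : ℝ) else 0) = n - r := by
    rw [Fin.sum_univ_eq_sum_range (fun i => if r ≤ i then (1 : ℝ) else 0),
      ← Finset.sum_range_add_sum_Ico _ hrn.le, Finset.sum_eq_zero, Finset.sum_congr rfl
        fun i hi => if_pos (Finset.mem_Ico.1 hi).1]
    · simp [Nat.cast_sub hrn.le]
    · intro i hi
      exact if_neg (by simpa using hi)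
  have key : ∀ i : Fin n, f ⟨r, hrn⟩ * (w i - if r ≤ (i : ℕ) then 1 else 0) ≤
      f i * w i - if r ≤ (i : ℕ) then f i else 0 := by
    intro i
    split_ifs with h
    · have := hf (show (⟨r, hrn⟩ : Fin n) ≤ i from h)
      nlinarith [hw1 i]
    · have := hf (show i ≤ (⟨r, hrn⟩ : Fin n) from (not_le.1 h).le)
      nlinarith [hw0 i]
  have hsum := Finset.sum_le_sum fun i (_ : i ∈ Finset.univ) => key i
  rw [← Finset.mul_sum, Finset.sum_sub_distrib, Finset.sum_sub_distrib, hcard] at hsum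
  have := mul_nonneg (hf0 ⟨r, hrn⟩) (sub_nonneg.2 hw)
  linarith

lemma frobNorm_sq {n m : ℕ} (A : Matrix (Fin n) (Fin m) ℝ) :
    frobNorm A ^ 2 = ∑ i, ∑ j, A i j ^ 2 :=
  Real.sq_sqrt (Finset.sum_nonneg fun _ _ => Finset.sum_nonneg fun _ _ => sq_nonneg _)

lemma frobNorm_sq_eq_sum_eigenvalues {n m : ℕ} (L : Matrix (Fin n) (Fin m) ℝ)
    (hH : (L * Lᵀ).IsHermitian) : frobNorm L ^ 2 = ∑ i, hH.eigenvalues i := by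
  have h := hH.trace_eq_sum_eigenvalues
  simp only [RCLike.ofReal_real_eq_id, id] at h
  rw [← h, frobNorm_sq]
  simp [Matrix.trace, Matrix.mul_apply, sq]

lemma sum_dotProduct_sq_le_frobNorm_sq {n m : ℕ} (M : Matrix (Fin n) (Fin m) ℝ) {ι : Type*}
    [Fintype ι] {v : ι → EuclideanSpace ℝ (Fin n)} (hv : Orthonormal ℝ v) :
    ∑ k, (Mᵀ *ᵥ (v k).ofLp) ⬝ᵥ (Mᵀ *ᵥ (v k).ofLp) ≤ frobNorm M ^ 2 := by
  have hcol : ∀ j, ∑ k, (Mᵀ *ᵥ (v k).ofLp) j ^ 2 ≤ ∑ i, M i j ^ 2 := by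
    intro j
    have := hv.sum_inner_products_le (WithLp.toLp 2 fun i => M i j) (s := Finset.univ)
    simpa [EuclideanSpace.inner_eq_star_dotProduct, EuclideanSpace.norm_sq_eq, Matrix.mulVec,
      dotProduct] using this
  rw [frobNorm_sq, Finset.sum_comm]
  simp only [dotProduct, ← sq]
  rw [Finset.sum_comm]
  exact Finset.sum_le_sum fun j _ => hcol j

lemma dotProduct_transpose_mulVec_self {n m : ℕ} (L : Matrix (Fin n) (Fin m) ℝ)
    (hH : (L * Lᵀ).IsHermitian) (v : EuclideanSpace ℝ (Fin n)) :
    (Lᵀ *ᵥ v.ofLp) ⬝ᵥ (Lᵀ *ᵥ v.ofLp) =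
      ∑ i, hH.eigenvalues i * inner ℝ v (hH.eigenvectorBasis i) ^ 2 := by
  have hs : (L * Lᵀ)ᵀ = L * Lᵀ := by simp
  have h1 : (Lᵀ *ᵥ v.ofLp) ⬝ᵥ (Lᵀ *ᵥ v.ofLp) =
      inner ℝ v (WithLp.toLp 2 ((L * Lᵀ) *ᵥ v.ofLp)) := by
    rw [EuclideanSpace.inner_eq_star_dotProduct, star_trivial, ← Matrix.mulVec_mulVec,
      Matrix.dotProduct_mulVec, Matrix.vecMul_transpose, dotProduct_comm]
  rw [h1, ← hH.eigenvectorBasis.sum_inner_mul_inner]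
  refine Finset.sum_congr rfl fun i _ => ?_
  have h2 : inner ℝ (hH.eigenvectorBasis i) (WithLp.toLp 2 ((L * Lᵀ) *ᵥ v.ofLp)) =
      hH.eigenvalues i * inner ℝ v (hH.eigenvectorBasis i) := by
    simp only [EuclideanSpace.inner_eq_star_dotProduct, star_trivial]
    rw [dotProduct_comm, Matrix.dotProduct_mulVec, ← Matrix.mulVec_transpose, hs,
      hH.mulVec_eigenvectorBasis, smul_dotProduct, smul_eq_mul]
  rw [h2]
  ring

/-- The lower bound in the Eckart–Young theorem for the Frobenius norm. -/
lemma sum_tail_sq_le_frobNorm_sub_sq {n m r : ℕ} (L A : Matrix (Fin n) (Fin m) ℝ)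
    (hH : (L * Lᵀ).IsHermitian) {f : Fin n → ℝ} (hf : Antitone f) (hf0 : ∀ i, 0 ≤ f i)
    (e : Equiv.Perm (Fin n)) (he : ∀ i, hH.eigenvalues (e i) = f i) (hA : A.rank ≤ r) :
    ∑ i : Fin n, (if r ≤ (i : ℕ) then f i else 0) ≤ frobNorm (L - A) ^ 2 := by
  let K : Submodule ℝ (EuclideanSpace ℝ (Fin n)) := LinearMap.ker (Matrix.toEuclideanLin Aᵀ)
  let b := stdOrthonormalBasis ℝ K
  let v : Fin (Module.finrank ℝ K) → EuclideanSpace ℝ (Fin n) := fun k => b k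
  have hv : Orthonormal ℝ v := b.orthonormal.comp_linearIsometry K.subtypeₗᵢ
  have hvA : ∀ k, Aᵀ *ᵥ (v k).ofLp = 0 := by
    intro k
    have h : Matrix.toEuclideanLin Aᵀ (v k) = 0 := (b k).2
    simpa [Matrix.toLpLin_apply] using h
  have hK : (n : ℝ) - r ≤ Module.finrank ℝ K := by
    have h := LinearMap.finrank_range_add_finrank_ker (Matrix.toEuclideanLin Aᵀ)
    have hrank : Module.finrank ℝ (LinearMap.range (Matrix.toEuclideanLin Aᵀ)) = A.rank := by
      rw [Matrix.toEuclideanLin_eq_toLin_orthonormal, ← Matrix.rank_eq_finrank_range_toLin,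
        Matrix.rank_transpose]
    rw [hrank, finrank_euclideanSpace_fin] at h
    have : n ≤ r + Module.finrank ℝ K := h.symm.le.trans (Nat.add_le_add_right hA _)
    have : (n : ℝ) ≤ r + Module.finrank ℝ K := by exact_mod_cast this
    linarith
  let u := hH.eigenvectorBasis
  let w : Fin n → ℝ := fun i => ∑ k, inner ℝ (v k) (u (e i)) ^ 2
  have hw1 : ∀ i, w i ≤ 1 := by
    intro i
    have := hv.sum_inner_products_le (u (e i)) (s := Finset.univ)
    simpa [u.orthonormal.norm_eq_one] using this
  have hw : ∑ i, w i = Module.finrank ℝ K := by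
    have hk : ∀ k, ∑ i, inner ℝ (v k) (u (e i)) ^ 2 = 1 := by
      intro k
      rw [Equiv.sum_comp e fun i => inner ℝ (v k) (u i) ^ 2]
      have := u.sum_sq_norm_inner_left (v k)
      simpa [hv.norm_eq_one] using this
    rw [Finset.sum_comm, Finset.sum_congr rfl fun k _ => hk k]
    simp
  calc ∑ i : Fin n, (if r ≤ (i : ℕ) then f i else 0)
      ≤ ∑ i, f i * w i := hf.sum_tail_le_sum_mul hf0
        (fun i => Finset.sum_nonneg fun _ _ => sq_nonneg _) hw1 (hw ▸ hK)
    _ = ∑ k, ((L - A)ᵀ *ᵥ (v k).ofLp) ⬝ᵥ ((L - A)ᵀ *ᵥ (v k).ofLp) := by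
        simp only [Matrix.transpose_sub, Matrix.sub_mulVec, hvA, sub_zero,
          dotProduct_transpose_mulVec_self L hH, w, Finset.mul_sum]
        rw [Finset.sum_comm]
        refine Finset.sum_congr rfl fun k _ => ?_
        rw [← Equiv.sum_comp e fun i =>
          hH.eigenvalues i * inner ℝ (v k) (hH.eigenvectorBasis i) ^ 2]
        simp only [he, u]
    _ ≤ _ := sum_dotProduct_sq_le_frobNorm_sq _ hv

/-- If the singular values of an `n × m` real matrix `L` (with `n ≤ m`)
satisfy `C₀ i^{-α} ≤ σᵢ ≤ C₁ i^{-α}` for some `0 < α < 1/2`, then there is an absolute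
constant `c > 0` such that every matrix `A` of rank at most `r ≤ n / 2^{1/(1-2α)}`
satisfies `‖L - A‖_F ≥ c (C₀/C₁) ‖L‖_F`.
The singular values are the (decreasingly ordered) square roots of the eigenvalues of
`L * Lᵀ`. -/
theorem stmt_1 :
    ∃ c : ℝ, 0 < c ∧
      ∀ (n m : ℕ), n ≤ m →
        ∀ (L : Matrix (Fin n) (Fin m) ℝ) (hH : (L * Lᵀ).IsHermitian)
          (σ : Fin n → ℝ) (C₀ C₁ α : ℝ),
          0 < C₀ → 0 < C₁ → 0 < α → α < (1 : ℝ) / 2 →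
          Antitone σ → (∀ i, 0 ≤ σ i) →
          (∃ e : Equiv.Perm (Fin n), ∀ i, hH.eigenvalues (e i) = (σ i) ^ 2) →
          (∀ i : Fin n, C₀ * ((i : ℝ) + 1) ^ (-α) ≤ σ i ∧
            σ i ≤ C₁ * ((i : ℝ) + 1) ^ (-α)) →
          ∀ r : ℕ, (r : ℝ) ≤ (n : ℝ) / 2 ^ ((1 : ℝ) / (1 - 2 * α)) →
            ∀ A : Matrix (Fin n) (Fin m) ℝ, A.rank ≤ r →
              c * (C₀ / C₁) * frobNorm L ≤ frobNorm (L - A) := by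
  refine ⟨1 / 2, by norm_num, ?_⟩
  intro n m _ L hH σ C₀ C₁ α hC₀ hC₁ hα0 hα1 hσ hσ0 ⟨e, he⟩ hbd r hr A hA
  set t : ℝ := 1 - 2 * α with ht
  have ht0 : 0 < t := by linarith
  have ht1 : t ≤ 1 := by linarith
  have hpow : (2 * (r : ℝ) ^ t) ≤ (n : ℝ) ^ t := by
    have h := (le_div_iff₀ (by positivity)).1 hr
    have h' := Real.rpow_le_rpow (by positivity) h ht0.le
    rwa [Real.mul_rpow (by positivity) (by positivity), ← Real.rpow_mul (by norm_num),
      one_div_mul_cancel ht0.ne', Real.rpow_one, mul_comm] at h'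
  have hrn : r ≤ n := by
    have h1 : (1 : ℝ) ≤ 2 ^ (1 / t) := Real.one_le_rpow (by norm_num) (by positivity)
    exact_mod_cast hr.trans (div_le_self (by positivity) h1)
  have hsq : ∀ C : ℝ, ∀ i : Fin n,
      (C * ((i : ℝ) + 1) ^ (-α)) ^ 2 = C ^ 2 * ((i : ℝ) + 1) ^ (t - 1) := by
    intro C i
    rw [mul_pow, ← Real.rpow_mul_natCast (by positivity)]
    congr 2
    rw [ht]; push_cast; ring
  have hupper : frobNorm L ^ 2 ≤ C₁ ^ 2 * ∑ i ∈ Finset.range n, ((i : ℝ) + 1) ^ (t - 1) := by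
    rw [frobNorm_sq_eq_sum_eigenvalues L hH, ← Equiv.sum_comp e,
      ← Fin.sum_univ_eq_sum_range (fun i => ((i : ℝ) + 1) ^ (t - 1)), Finset.mul_sum]
    refine Finset.sum_le_sum fun i _ => ?_
    rw [he, ← hsq]
    exact pow_le_pow_left₀ (hσ0 i) (hbd i).2 2
  have hlower : C₀ ^ 2 * ∑ i ∈ Finset.Ico r n, ((i : ℝ) + 1) ^ (t - 1) ≤
      frobNorm (L - A) ^ 2 := by
    refine le_trans ?_ (sum_tail_sq_le_frobNorm_sub_sq L A hH (f := fun i => σ i ^ 2)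
      (fun i j hij => pow_le_pow_left₀ (hσ0 j) (hσ hij) 2) (fun i => sq_nonneg _) e he hA)
    have hIco : ∑ i ∈ Finset.Ico r n, ((i : ℝ) + 1) ^ (t - 1) =
        ∑ i : Fin n, if r ≤ (i : ℕ) then ((i : ℝ) + 1) ^ (t - 1) else 0 := by
      rw [Fin.sum_univ_eq_sum_range (fun i => if r ≤ i then ((i : ℝ) + 1) ^ (t - 1) else 0),
        ← Finset.sum_filter]
      congr 1
      ext i
      simp [and_comm]
    rw [hIco, Finset.mul_sum]
    refine Finset.sum_le_sum fun i _ => ?_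
    split_ifs
    · rw [← hsq]
      exact pow_le_pow_left₀ (by positivity) (hbd i).1 2
    · simp
  have hsum := sum_range_rpow_le_three_mul_sum_Ico ht0 ht1 hrn hpow
  refine le_of_sq_le_sq ?_ (Real.sqrt_nonneg _)
  calc (1 / 2 * (C₀ / C₁) * frobNorm L) ^ 2
      = (C₀ / C₁) ^ 2 / 4 * frobNorm L ^ 2 := by ring
    _ ≤ (C₀ / C₁) ^ 2 / 4 * (C₁ ^ 2 * (3 * ∑ i ∈ Finset.Ico r n, ((i : ℝ) + 1) ^ (t - 1))) := by
        gcongr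
        exact hupper.trans (by gcongr)
    _ = 3 / 4 * (C₀ ^ 2 * ∑ i ∈ Finset.Ico r n, ((i : ℝ) + 1) ^ (t - 1)) := by
        field_simp
    _ ≤ frobNorm (L - A) ^ 2 := by
        linarith [sq_nonneg (frobNorm (L - A))]
end

section
/- For any vectors v, v' ∈ ℝ^d, the Kullback–Leibler divergence between the probability distributions softmax(v) and softmax(v') on [d] satisfies KL(softmax(v) ‖ softmax(v')) ≤ (1/2) · ‖v − v'‖_2². -/
/-- The softmax distribution on `Fin d` associated to a vector `v`. -/
noncomputable def softmax {d : ℕ} (v : Fin d → ℝ) (i : Fin d) : ℝ :=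
  Real.exp (v i) / ∑ j, Real.exp (v j)

/-- KL divergence between two distributions on `Fin d`. -/
noncomputable def klDiv {d : ℕ} (p q : Fin d → ℝ) : ℝ :=
  ∑ i, p i * Real.log (p i / q i)

open MeasureTheory ProbabilityTheory in
/-- **Hoeffding's lemma** for a finitely supported random variable. -/
theorem sum_mul_exp_le_of_mem_Icc {ι : Type*} [Fintype ι] {p u : ι → ℝ} {a b : ℝ}
    (hp : ∀ i, 0 ≤ p i) (hp_sum : ∑ i, p i = 1) (hu : ∀ i, u i ∈ Set.Icc a b) :
    ∑ i, p i * Real.exp (u i) ≤ Real.exp (∑ i, p i * u i + (b - a) ^ 2 / 8) := by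
  let _ : MeasurableSpace ι := ⊤
  let P : PMF ι := PMF.ofFintype (fun i => ENNReal.ofReal (p i)) (by
    rw [← ENNReal.ofReal_sum_of_nonneg fun i _ => hp i, hp_sum, ENNReal.ofReal_one])
  have hint (f : ι → ℝ) : ∫ i, f i ∂P.toMeasure = ∑ i, p i * f i := by
    simp [PMF.integral_eq_sum, P, ENNReal.toReal_ofReal, hp]
  have h := (hasSubgaussianMGF_of_mem_Icc (μ := P.toMeasure) (X := u)
    (measurable_from_top).aemeasurable (Filter.Eventually.of_forall hu)).mgf_le 1
  rw [mgf, hint, hint] at h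
  simp only [one_mul, Real.exp_sub, mul_div_assoc', ← Finset.sum_div] at h
  rw [div_le_iff₀ (Real.exp_pos _), ← Real.exp_add] at h
  refine h.trans_eq (congrArg Real.exp ?_)
  push_cast
  rw [Real.norm_eq_abs, div_pow, sq_abs]
  ring

theorem sq_sub_le_two_mul_sum_sq {ι : Type*} [Fintype ι] (u : ι → ℝ) (i j : ι) :
    (u i - u j) ^ 2 ≤ 2 * ∑ k, u k ^ 2 := by
  classical
  rcases eq_or_ne i j with rfl | hij
  · simpa using Finset.sum_nonneg fun k _ => sq_nonneg (u k)
  · have h := Finset.sum_le_sum_of_subset_of_nonneg (Finset.subset_univ {i, j})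
      fun k _ _ => sq_nonneg (u k)
    rw [Finset.sum_pair hij] at h
    nlinarith [sq_nonneg (u i + u j)]

theorem sum_softmax_mul_exp_sub {d : ℕ} (v v' : Fin d → ℝ) :
    ∑ i, softmax v i * Real.exp (v' i - v i) =
      (∑ j, Real.exp (v' j)) / ∑ j, Real.exp (v j) := by
  rw [Finset.sum_div]
  refine Finset.sum_congr rfl fun i _ => ?_
  rw [softmax, div_mul_eq_mul_div, ← Real.exp_add, add_sub_cancel]

section softmax

variable {d : ℕ} [NeZero d]

theorem sum_exp_pos (v : Fin d → ℝ) : 0 < ∑ j, Real.exp (v j) :=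
  Finset.sum_pos (fun _ _ => Real.exp_pos _) Finset.univ_nonempty

theorem softmax_pos (v : Fin d → ℝ) (i : Fin d) : 0 < softmax v i :=
  div_pos (Real.exp_pos _) (sum_exp_pos v)

theorem sum_softmax (v : Fin d → ℝ) : ∑ i, softmax v i = 1 := by
  simp only [softmax, ← Finset.sum_div]
  exact div_self (sum_exp_pos v).ne'

theorem klDiv_softmax (v v' : Fin d → ℝ) :
    klDiv (softmax v) (softmax v') =
      Real.log (∑ i, softmax v i * Real.exp (v' i - v i)) -
        ∑ i, softmax v i * (v' i - v i) := by
  have hv := (sum_exp_pos v).ne'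
  have hv' := (sum_exp_pos v').ne'
  have hlog (i : Fin d) : Real.log (softmax v i / softmax v' i) =
      Real.log ((∑ j, Real.exp (v' j)) / ∑ j, Real.exp (v j)) - (v' i - v i) := by
    rw [Real.log_div (softmax_pos v i).ne' (softmax_pos v' i).ne', softmax, softmax,
      Real.log_div (Real.exp_ne_zero _) hv, Real.log_div (Real.exp_ne_zero _) hv',
      Real.log_div hv' hv, Real.log_exp, Real.log_exp]
    ring
  simp only [klDiv, hlog, mul_sub (softmax v _) (Real.log _), Finset.sum_sub_distrib,
    ← Finset.sum_mul, sum_softmax, one_mul, sum_softmax_mul_exp_sub]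

end softmax

/-- `KL(softmax v ‖ softmax v') ≤ (1/2) ‖v - v'‖₂²`. -/
theorem stmt_2 {d : ℕ} (v v' : Fin d → ℝ) :
    klDiv (softmax v) (softmax v') ≤ (1 / 2) * ∑ i, (v i - v' i) ^ 2 := by
  rcases Nat.eq_zero_or_pos d with rfl | hd
  · simp [klDiv]
  have : NeZero d := ⟨hd.ne'⟩
  obtain ⟨m, hm⟩ := Finite.exists_min fun i => v' i - v i
  obtain ⟨M, hM⟩ := Finite.exists_max fun i => v' i - v i
  have h := sum_mul_exp_le_of_mem_Icc (fun i => (softmax_pos v i).le) (sum_softmax v)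
    fun i => ⟨hm i, hM i⟩
  have hpos : 0 < ∑ i, softmax v i * Real.exp (v' i - v i) := by
    rw [sum_softmax_mul_exp_sub]
    exact div_pos (sum_exp_pos v') (sum_exp_pos v)
  have hlog := (Real.log_le_iff_le_exp hpos).2 h
  have hsq := sq_sub_le_two_mul_sum_sq (fun i => v' i - v i) M m
  have hnonneg : 0 ≤ ∑ i, (v i - v' i) ^ 2 := Finset.sum_nonneg fun i _ => sq_nonneg _
  simp only [sub_sq_comm (v' _) (v _)] at hsq
  rw [klDiv_softmax]
  linarith
end

section
/- Fix finite sets H of size n and F of size m, and a finite alphabet Σ. For any matrices A, A' ∈ ℝ^{H × (F × Σ)}, writing A_{h,f} ∈ ℝ^Σ for the vector (A_{h,(f,z)})_{z∈Σ}, it holds that Σ_{h∈H, f∈F} KL(softmax(A_{h,f}) ‖ softmax(A'_{h,f})) ≤ (1/2) · ‖A − A'‖_F². -/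
/-- The softmax distribution on a finite type associated to a vector `v`. -/
noncomputable def softmaxF {S : Type*} [Fintype S] (v : S → ℝ) (z : S) : ℝ :=
  Real.exp (v z) / ∑ z', Real.exp (v z')

/-- KL divergence between two distributions on a finite type. -/
noncomputable def klDivF {S : Type*} [Fintype S] (p q : S → ℝ) : ℝ :=
  ∑ z, p z * Real.log (p z / q z)

open MeasureTheory ProbabilityTheory in
/-- Hoeffding's lemma for a finitely supported distribution, with the range of `d` bounded by its
Euclidean norm. -/
theorem sum_mul_exp_le_of_sum_eq_one {S : Type*} [Fintype S] {p : S → ℝ} (hp : ∀ z, 0 ≤ p z)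
    (hsum : ∑ z, p z = 1) (d : S → ℝ) :
    ∑ z, p z * Real.exp (d z) ≤ Real.exp (∑ z, p z * d z + 1 / 2 * ∑ z, d z ^ 2) := by
  let _ : MeasurableSpace S := ⊤
  let μ : Measure S := ∑ z, ENNReal.ofReal (p z) • Measure.dirac z
  have hprob : IsProbabilityMeasure μ := by
    constructor
    simp [μ, ← ENNReal.ofReal_sum_of_nonneg fun z _ => hp z, hsum]
  have hint (g : S → ℝ) : ∫ z, g z ∂μ = ∑ z, p z * g z := by
    have hg : ∀ z ∈ Finset.univ, Integrable g (ENNReal.ofReal (p z) • Measure.dirac z) :=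
      fun z _ =>
      (Integrable.of_finite (μ := Measure.dirac z)).smul_measure ENNReal.ofReal_ne_top
    rw [integral_finsetSum_measure hg]
    simp [hp]
  set R := Real.sqrt (∑ z, d z ^ 2) with hR
  have hbound : ∀ᵐ z ∂μ, d z ∈ Set.Icc (-R) R := by
    refine ae_of_all _ fun z => abs_le.mp (Real.abs_le_sqrt ?_)
    exact Finset.single_le_sum (f := fun z => d z ^ 2) (fun _ _ => sq_nonneg _)
      (Finset.mem_univ z)
  have hmeas : AEMeasurable d μ := measurable_from_top.aemeasurable
  have hmgf := (hasSubgaussianMGF_of_mem_Icc hmeas hbound).mgf_le 1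
  have hR2 : R ^ 2 = ∑ z, d z ^ 2 := Real.sq_sqrt (Finset.sum_nonneg fun _ _ => sq_nonneg _)
  have hR0 : 0 ≤ R := Real.sqrt_nonneg _
  have hrad : ((R - -R) / 2) ^ 2 = R ^ 2 := by ring
  simp only [mgf, hint, one_mul, Real.exp_sub, NNReal.coe_pow, NNReal.coe_div, coe_nnnorm,
    NNReal.coe_ofNat, Real.norm_of_nonneg (by linarith : 0 ≤ R - -R), hrad, hR2, ← mul_div_assoc,
    ← Finset.sum_div] at hmgf
  rw [div_le_iff₀ (Real.exp_pos _), ← Real.exp_add] at hmgf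
  refine hmgf.trans_eq (congrArg Real.exp ?_)
  ring

theorem softmaxF_pos {S : Type*} [Fintype S] [Nonempty S] (v : S → ℝ) (z : S) :
    0 < softmaxF v z :=
  div_pos (Real.exp_pos _)
    (Finset.sum_pos (fun _ _ => Real.exp_pos _) Finset.univ_nonempty)

theorem sum_softmaxF {S : Type*} [Fintype S] [Nonempty S] (v : S → ℝ) :
    ∑ z, softmaxF v z = 1 := by
  simp only [softmaxF, ← Finset.sum_div]
  exact div_self (Finset.sum_pos (fun _ _ => Real.exp_pos _) Finset.univ_nonempty).ne'

theorem klDivF_softmaxF_eq {S : Type*} [Fintype S] [Nonempty S] (a b : S → ℝ) :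
    klDivF (softmaxF a) (softmaxF b) =
      Real.log (∑ z, softmaxF a z * Real.exp (b z - a z)) -
        ∑ z, softmaxF a z * (b z - a z) := by
  have hZ (v : S → ℝ) : 0 < ∑ z, Real.exp (v z) :=
    Finset.sum_pos (fun _ _ => Real.exp_pos _) Finset.univ_nonempty
  have hratio : ∑ z, softmaxF a z * Real.exp (b z - a z) =
      (∑ z, Real.exp (b z)) / ∑ z, Real.exp (a z) := by
    rw [Finset.sum_div]
    refine Finset.sum_congr rfl fun z _ => ?_
    rw [softmaxF, Real.exp_sub]
    field_simp
  have hlog (z : S) : Real.log (softmaxF a z / softmaxF b z) =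
      Real.log ((∑ z, Real.exp (b z)) / ∑ z, Real.exp (a z)) - (b z - a z) := by
    rw [Real.log_div (softmaxF_pos a z).ne' (softmaxF_pos b z).ne', softmaxF, softmaxF,
      Real.log_div (Real.exp_pos _).ne' (hZ a).ne', Real.log_div (Real.exp_pos _).ne' (hZ b).ne',
      Real.log_div (hZ b).ne' (hZ a).ne', Real.log_exp, Real.log_exp]
    ring
  simp only [klDivF, hratio, hlog]
  simp only [mul_sub _ (Real.log _), Finset.sum_sub_distrib, ← Finset.sum_mul, sum_softmaxF,
    one_mul]

theorem klDivF_softmaxF_le {S : Type*} [Fintype S] (a b : S → ℝ) :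
    klDivF (softmaxF a) (softmaxF b) ≤ 1 / 2 * ∑ z, (a z - b z) ^ 2 := by
  cases isEmpty_or_nonempty S
  · simp [klDivF]
  · rw [klDivF_softmaxF_eq, sub_le_iff_le_add', Real.log_le_iff_le_exp
      (Finset.sum_pos (fun z _ => mul_pos (softmaxF_pos a z) (Real.exp_pos _))
        Finset.univ_nonempty)]
    simp only [sub_sq_comm (a _)]
    exact sum_mul_exp_le_of_sum_eq_one (fun z => (softmaxF_pos a z).le) (sum_softmaxF a) _

/-- for matrices `A, A' ∈ ℝ^{H × (F × Σ)}`, the sum over `(h, f)` of the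
KL divergences between the softmax next-token distributions induced by the slices
`A_{h,f}, A'_{h,f} ∈ ℝ^Σ` is at most `(1/2) ‖A - A'‖_F²`. -/
theorem stmt_5 (H F S : Type*) [Fintype H] [Fintype F] [Fintype S]
    (A A' : Matrix H (F × S) ℝ) :
    ∑ h : H, ∑ f : F,
        klDivF (softmaxF fun z => A h (f, z)) (softmaxF fun z => A' h (f, z))
      ≤ (1 / 2) * ∑ h : H, ∑ p : F × S, (A h p - A' h p) ^ 2 := by
  rw [Finset.mul_sum]
  refine Finset.sum_le_sum fun h _ => ?_
  rw [Fintype.sum_prod_type, Finset.mul_sum]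
  exact Finset.sum_le_sum fun f _ => klDivF_softmaxF_le _ _
end

section
/- Let M be a language model over sequences of length T over a finite alphabet Σ, assigning positive probability to every sequence, such that for each t ∈ {0,1,…,T−1} the extended logit matrix L_M(Σ^t, Σ^{≤T−t}) has rank at most d. Then there exists a time-varying ISAN of sequence length T with hidden dimension d that generates exactly the same distribution over Σ^T as M. -/
/-- Hidden states of a time-varying ISAN along the token sequence `z`. -/
noncomputable def tvState {S : Type*} {d : ℕ}
    (A : S → ℕ → Matrix (Fin d) (Fin d) ℝ) (x0 : Fin d → ℝ) (z : ℕ → S) :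
    ℕ → Fin d → ℝ
  | 0 => x0
  | t + 1 => (A (z t) t).mulVec (tvState A x0 z t)

/-- Probability that a time-varying ISAN of sequence length `T` generates the tokens
`z 0, …, z (T-1)`. -/
noncomputable def tvProb {S : Type*} [Fintype S] {d : ℕ} (T : ℕ)
    (A : S → ℕ → Matrix (Fin d) (Fin d) ℝ) (B : ℕ → Matrix S (Fin d) ℝ)
    (x0 : Fin d → ℝ) (z : ℕ → S) : ℝ :=
  ∏ t ∈ Finset.range T, softmaxF ((B t).mulVec (tvState A x0 z t)) (z t)

/-- Extend a finite sequence to `ℕ → S` (junk beyond `T`). -/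
noncomputable def extSeq {S : Type*} [Nonempty S] {T : ℕ} (z : Fin T → S) : ℕ → S :=
  fun k => if h : k < T then z ⟨k, h⟩ else Classical.arbitrary S

/-- Probability under the language model `M` (a distribution on `Σ^T`) that the generated
sequence has the list `y` as a prefix. -/
noncomputable def prefProb {S : Type*} [Fintype S] [DecidableEq S] {T : ℕ}
    (M : (Fin T → S) → ℝ) (y : List S) : ℝ :=
  ∑ z ∈ Finset.univ.filter (fun z : Fin T → S => (List.ofFn z).take y.length = y), M z

/-- Conditional probability `Pr_M[z ∣ y]` that the next token after the prefix `y` is `z`. -/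
noncomputable def condProb {S : Type*} [Fintype S] [DecidableEq S] {T : ℕ}
    (M : (Fin T → S) → ℝ) (y : List S) (z : S) : ℝ :=
  prefProb M (y ++ [z]) / prefProb M y

/-- Mean-centered logits `L_M[z ∣ y]`. -/
noncomputable def mcLogit {S : Type*} [Fintype S] [DecidableEq S] {T : ℕ}
    (M : (Fin T → S) → ℝ) (y : List S) (z : S) : ℝ :=
  Real.log (condProb M y z)
    - (1 / (Fintype.card S : ℝ)) * ∑ z', Real.log (condProb M y z')

/-- Extended logit matrix `L_M(H, F)`: rows indexed by histories, columns by
(future, token) pairs, with entry `L_M[z ∣ h ∘ f]`. -/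
noncomputable def logitMatrix {S : Type*} [Fintype S] [DecidableEq S] {T : ℕ}
    (M : (Fin T → S) → ℝ) {H F : Type*} (hist : H → List S) (fut : F → List S) :
    Matrix H (F × S) ℝ :=
  Matrix.of fun h p => mcLogit M (hist h ++ fut p.1) p.2

section PrefixProbabilities

variable {S : Type*} [Fintype S] [DecidableEq S] {T : ℕ} (M : (Fin T → S) → ℝ)

lemma prefProb_nil : prefProb M [] = ∑ z, M z := by
  simp [prefProb]

lemma prefProb_ofFn (z : Fin T → S) : prefProb M (List.ofFn z) = M z := by
  have h : (Finset.univ.filter fun w : Fin T → S =>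
      (List.ofFn w).take (List.ofFn z).length = List.ofFn z) = {z} := by
    ext w
    simp only [Finset.mem_filter, Finset.mem_univ, true_and, Finset.mem_singleton,
      List.length_ofFn]
    rw [List.take_of_length_le (by simp)]
    exact List.ofFn_injective.eq_iff
  rw [prefProb, h, Finset.sum_singleton]

lemma prefProb_pos [Nonempty S] (hpos : ∀ z, 0 < M z) {y : List S} (hy : y.length ≤ T) :
    0 < prefProb M y := by
  refine Finset.sum_pos (fun z _ => hpos z) ⟨fun i => y.getD i (Classical.arbitrary S), ?_⟩
  simp only [Finset.mem_filter, Finset.mem_univ, true_and]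
  refine List.ext_getElem (by simpa using hy) fun i h₁ h₂ => ?_
  simp [h₂]

lemma prefProb_eq_zero_of_lt_length {y : List S} (hy : T < y.length) : prefProb M y = 0 := by
  refine Finset.sum_eq_zero fun z hz => ?_
  have h := congrArg List.length (Finset.mem_filter.1 hz).2
  simp only [List.length_take, List.length_ofFn] at h
  omega

lemma sum_prefProb_append_singleton {y : List S} (hy : y.length < T) :
    ∑ c, prefProb M (y ++ [c]) = prefProb M y := by
  simp only [prefProb, Finset.sum_filter]
  rw [Finset.sum_comm]
  refine Finset.sum_congr rfl fun z _ => ?_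
  have key : ∀ c, ((List.ofFn z).take (y ++ [c]).length = y ++ [c]) ↔
      ((List.ofFn z).take y.length = y ∧ z ⟨y.length, hy⟩ = c) := by
    intro c
    have h : (List.ofFn z).take (y ++ [c]).length =
        (List.ofFn z).take y.length ++ [z ⟨y.length, hy⟩] := by
      simp [List.take_add_one, hy]
    rw [h, List.append_singleton_inj]
  simp only [key]
  by_cases h : (List.ofFn z).take y.length = y <;> simp [h]

lemma condProb_pos [Nonempty S] (hpos : ∀ z, 0 < M z) {y : List S} (hy : y.length < T) (c : S) :
    0 < condProb M y c :=
  div_pos (prefProb_pos M hpos (by simpa using hy)) (prefProb_pos M hpos hy.le)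

lemma sum_condProb [Nonempty S] (hpos : ∀ z, 0 < M z) {y : List S} (hy : y.length < T) :
    ∑ c, condProb M y c = 1 := by
  simp only [condProb]
  rw [← Finset.sum_div, sum_prefProb_append_singleton M hy,
    div_self (prefProb_pos M hpos hy.le).ne']

lemma mcLogit_eq_zero_of_le_length {y : List S} (hy : T ≤ y.length) (c : S) :
    mcLogit M y c = 0 := by
  have h : ∀ c, condProb M y c = 0 := fun c => by
    rw [condProb, prefProb_eq_zero_of_lt_length M (by simp; omega), zero_div]
  simp [mcLogit, h]

lemma softmaxF_mcLogit [Nonempty S] (hpos : ∀ z, 0 < M z) {y : List S} (hy : y.length < T)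
    (c : S) : softmaxF (mcLogit M y) c = condProb M y c := by
  have h : ∀ c, Real.exp (mcLogit M y c) = condProb M y c /
      Real.exp ((1 / (Fintype.card S : ℝ)) * ∑ z', Real.log (condProb M y z')) := fun c => by
    rw [mcLogit, Real.exp_sub, Real.exp_log (condProb_pos M hpos hy c)]
  simp only [softmaxF, h]
  rw [← Finset.sum_div, sum_condProb M hpos hy, div_div_div_cancel_right₀ (Real.exp_ne_zero _),
    div_one]

lemma prod_condProb_map_range [Nonempty S] (hpos : ∀ z, 0 < M z) (hsum : ∑ z, M z = 1)
    (z : ℕ → S) {t : ℕ} (ht : t ≤ T) :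
    ∏ i ∈ Finset.range t, condProb M ((List.range i).map z) (z i) =
      prefProb M ((List.range t).map z) := by
  induction t with
  | zero => simp [prefProb_nil, hsum]
  | succ t ih =>
    rw [Finset.prod_range_succ, ih (by omega), condProb, List.range_succ, List.map_append,
      List.map_singleton]
    exact mul_div_cancel₀ _ (prefProb_pos M hpos (by simp; omega)).ne'

end PrefixProbabilities

/-- A finite-dimensional subspace of dimension at most `d` is a retract of `Fin d → K`
inside the ambient space. -/
lemma Submodule.exists_linearMap_fin_comp_eq_self {K V : Type*} [Field K] [AddCommGroup V]
    [Module K V] {d : ℕ} (W : Submodule K V) [FiniteDimensional K W]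
    (hW : Module.finrank K W ≤ d) :
    ∃ (φ : V →ₗ[K] (Fin d → K)) (ψ : (Fin d → K) →ₗ[K] V), ∀ v ∈ W, ψ (φ v) = v := by
  obtain ⟨f, hf⟩ : ∃ f : W →ₗ[K] (Fin d → K), Function.Injective f := by
    let e := (Module.finBasis K W).equivFun
    refine ⟨(Function.ExtendByZero.linearMap K (Fin.castLE hW)).comp e.toLinearMap, ?_⟩
    rw [LinearMap.coe_comp]
    refine Function.Injective.comp (fun a b hab => ?_) e.injective
    funext i
    have h := congrFun hab (Fin.castLE hW i)
    simpa [(Fin.castLE_injective hW).extend_apply] using h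
  obtain ⟨g, hg⟩ := f.exists_leftInverse_of_injective (LinearMap.ker_eq_bot.2 hf)
  obtain ⟨φ, hφ⟩ := f.exists_extend
  refine ⟨φ, W.subtype.comp g, fun v hv => ?_⟩
  have h₁ : φ v = f ⟨v, hv⟩ := LinearMap.congr_fun hφ ⟨v, hv⟩
  have h₂ : g (f ⟨v, hv⟩) = ⟨v, hv⟩ := LinearMap.congr_fun hg ⟨v, hv⟩
  simp [h₁, h₂]

section LogitRows

variable {S : Type*} [Fintype S] [DecidableEq S] {T : ℕ} (M : (Fin T → S) → ℝ)

/-- The mean-centered logits after the history `y`, as a function of the future. -/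
noncomputable def logitRow (y : List S) : List S → S → ℝ :=
  fun f => mcLogit M (y ++ f)

/-- The span of the logit rows of all histories of length `t`. -/
noncomputable def logitRowSpan (t : ℕ) : Submodule ℝ (List S → S → ℝ) :=
  Submodule.span ℝ (logitRow M '' {y | y.length = t})

/-- Extension by zero of a function of futures of length at most `n` to all futures. -/
def extendFutures (S : Type*) (n : ℕ) :
    (((j : Fin (n + 1)) × (Fin (j : ℕ) → S)) × S → ℝ) →ₗ[ℝ] (List S → S → ℝ) where
  toFun w f c := if h : f.length < n + 1 then w (⟨⟨f.length, h⟩, f.get⟩, c) else 0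
  map_add' v w := by
    funext f c
    simp only [Pi.add_apply]
    split_ifs <;> simp
  map_smul' a w := by
    funext f c
    simp only [Pi.smul_apply]
    split_ifs <;> simp

lemma extendFutures_logitMatrix {t : ℕ} (h : Fin t → S) :
    extendFutures S (T - t) ((logitMatrix M (fun h : Fin t → S => List.ofFn h)
        (fun f : (j : Fin (T - t + 1)) × (Fin (j : ℕ) → S) => List.ofFn f.2)).row h) =
      logitRow M (List.ofFn h) := by
  funext f c
  by_cases hf : f.length < T - t + 1
  · simp only [extendFutures, LinearMap.coe_mk, AddHom.coe_mk, hf, dite_true]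
    simp [logitMatrix, logitRow, Matrix.row]
  · simp only [extendFutures, LinearMap.coe_mk, AddHom.coe_mk, hf, dite_false]
    exact (mcLogit_eq_zero_of_le_length M (by simp; omega) c).symm

lemma logitRowSpan_eq_map (t : ℕ) :
    logitRowSpan M t = (Submodule.span ℝ (Set.range
      (logitMatrix M (fun h : Fin t → S => List.ofFn h)
        (fun f : (j : Fin (T - t + 1)) × (Fin (j : ℕ) → S) => List.ofFn f.2)).row)).map
      (extendFutures S (T - t)) := by
  rw [Submodule.map_span, logitRowSpan, ← Set.range_comp]
  congr 1
  ext v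
  constructor
  · rintro ⟨y, rfl, rfl⟩
    exact ⟨y.get, by simp [extendFutures_logitMatrix]⟩
  · rintro ⟨h, rfl⟩
    exact ⟨List.ofFn h, by simp, (extendFutures_logitMatrix M h).symm⟩

instance (t : ℕ) : FiniteDimensional ℝ (logitRowSpan M t) := by
  rw [logitRowSpan_eq_map]
  infer_instance

lemma finrank_logitRowSpan_le (t : ℕ) :
    Module.finrank ℝ (logitRowSpan M t) ≤
      (logitMatrix M (fun h : Fin t → S => List.ofFn h)
        (fun f : (j : Fin (T - t + 1)) × (Fin (j : ℕ) → S) => List.ofFn f.2)).rank := by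
  rw [logitRowSpan_eq_map, Matrix.rank_eq_finrank_span_row]
  exact Submodule.finrank_map_le _ _

lemma logitRow_mem_logitRowSpan (y : List S) : logitRow M y ∈ logitRowSpan M y.length :=
  Submodule.subset_span ⟨y, rfl, rfl⟩

end LogitRows

/-- Restriction of a function of the future to the futures that start with `c`. -/
def shiftFuture {S : Type*} (c : S) : (List S → S → ℝ) →ₗ[ℝ] (List S → S → ℝ) :=
  LinearMap.funLeft ℝ (S → ℝ) (List.cons c)

/-- if a language model `M` on `Σ^T` with full support has extended logit
matrices `L_M(Σ^t, Σ^{≤T−t})` of rank at most `d` for all `t ∈ {0, …, T−1}`, then `M` is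
generated by a time-varying ISAN of sequence length `T` with hidden dimension `d`. -/
theorem stmt_7 {S : Type*} [Fintype S] [DecidableEq S] [Nonempty S] (T d : ℕ)
    (M : (Fin T → S) → ℝ) (hpos : ∀ z, 0 < M z) (hsum : ∑ z, M z = 1)
    (hrank : ∀ t : ℕ, t < T →
      (logitMatrix M (fun h : Fin t → S => List.ofFn h)
        (fun f : (j : Fin (T - t + 1)) × (Fin (j : ℕ) → S) => List.ofFn f.2)).rank ≤ d) :
    ∃ (A : S → ℕ → Matrix (Fin d) (Fin d) ℝ) (B : ℕ → Matrix S (Fin d) ℝ)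
      (x0 : Fin d → ℝ),
      ∀ z : Fin T → S, M z = tvProb T A B x0 (extSeq z) := by
  have hex : ∀ t, ∃ (φ : (List S → S → ℝ) →ₗ[ℝ] (Fin d → ℝ))
      (ψ : (Fin d → ℝ) →ₗ[ℝ] (List S → S → ℝ)),
      t < T → ∀ v ∈ logitRowSpan M t, ψ (φ v) = v := fun t => by
    by_cases ht : t < T
    · obtain ⟨φ, ψ, h⟩ := (logitRowSpan M t).exists_linearMap_fin_comp_eq_self
        ((finrank_logitRowSpan_le M t).trans (hrank t ht))
      exact ⟨φ, ψ, fun _ => h⟩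
    · exact ⟨0, 0, fun h => absurd h ht⟩
  choose φ ψ hφψ using hex
  have hrow : ∀ (z : ℕ → S) (t : ℕ), t < T →
      ψ t (φ t (logitRow M ((List.range t).map z))) = logitRow M ((List.range t).map z) :=
    fun z t ht => hφψ t ht _ (by
      simpa using logitRow_mem_logitRowSpan M ((List.range t).map z))
  set A : S → ℕ → Matrix (Fin d) (Fin d) ℝ := fun c t =>
    LinearMap.toMatrix' (φ (t + 1) ∘ₗ shiftFuture c ∘ₗ ψ t) with hA
  set B : ℕ → Matrix S (Fin d) ℝ := fun t =>
    LinearMap.toMatrix' (LinearMap.proj [] ∘ₗ ψ t) with hB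
  set x0 : Fin d → ℝ := φ 0 (logitRow M []) with hx0
  have hstate : ∀ (z : ℕ → S) (t : ℕ), t < T →
      tvState A x0 z t = φ t (logitRow M ((List.range t).map z)) := by
    intro z t
    induction t with
    | zero => intro _; simp [tvState, hx0]
    | succ t ih =>
      intro ht
      rw [tvState, ih (by omega), hA]
      simp only [LinearMap.toMatrix'_mulVec, LinearMap.comp_apply]
      rw [hrow z t (by omega)]
      congr 1
      funext f
      simp [shiftFuture, LinearMap.funLeft, logitRow, List.range_succ]
  refine ⟨A, B, x0, fun z => ?_⟩
  have hz : (List.range T).map (extSeq z) = List.ofFn z :=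
    List.ext_getElem (by simp) fun i h₁ h₂ => by
      have hi : i < T := by simpa using h₁
      simp [extSeq, hi]
  rw [← prefProb_ofFn M z, ← hz, ← prod_condProb_map_range M hpos hsum _ le_rfl, tvProb]
  refine Finset.prod_congr rfl fun t ht => ?_
  have ht' : t < T := Finset.mem_range.1 ht
  rw [← softmaxF_mcLogit M hpos (by simpa using ht'), hstate _ t ht', hB]
  simp only [LinearMap.toMatrix'_mulVec, LinearMap.comp_apply]
  rw [hrow _ t ht']
  simp [logitRow]
end

section
/- Every linear-in-state SSM with input dimension p, output dimension q, and hidden state dimension d can be expressed as an ISAN with hidden dimension d + 2q + 1, i.e., there is an ISAN with hidden dimension d + 2q + 1 generating the same distribution over token sequences. -/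
/-- One-hot encoding of a token. -/
noncomputable def oneHot {S : Type*} [DecidableEq S] (z : S) : S → ℝ :=
  fun s => if s = z then 1 else 0

/-- The pair (hidden state `x_t`, next input `u_{t+1}`) of a linear-in-state SSM after
the tokens `z 0, …, z (t-1)` have been produced.  The selective state space layer has
input-dependent matrices `A, B`, embedding matrix `V`, initial hidden state `x0`, and
initial input `u1`. -/
noncomputable def ssmState {S : Type*} [Fintype S] [DecidableEq S] {p d : ℕ}
    (A : (Fin p → ℝ) → Matrix (Fin d) (Fin d) ℝ)
    (B : (Fin p → ℝ) → Matrix (Fin d) (Fin p) ℝ)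
    (V : Matrix (Fin p) S ℝ) (x0 : Fin d → ℝ) (u1 : Fin p → ℝ) (z : ℕ → S) :
    ℕ → (Fin d → ℝ) × (Fin p → ℝ)
  | 0 => (x0, u1)
  | t + 1 =>
    ((A (ssmState A B V x0 u1 z t).2).mulVec (ssmState A B V x0 u1 z t).1
        + (B (ssmState A B V x0 u1 z t).2).mulVec (ssmState A B V x0 u1 z t).2,
      V.mulVec (oneHot (z t)))

/-- Probability that a linear-in-state SSM generates the tokens `z 0, …, z (T-1)`:
with `(x_{t}, u_{t+1}) = ssmState … t`, the output is
`y_{t+1} = C(u_{t+1}) x_t + D(u_{t+1}) u_{t+1}` and the next token is sampled from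
`softmax (U y_{t+1})`. -/
noncomputable def ssmProb {S : Type*} [Fintype S] [DecidableEq S] {p q d : ℕ}
    (A : (Fin p → ℝ) → Matrix (Fin d) (Fin d) ℝ)
    (B : (Fin p → ℝ) → Matrix (Fin d) (Fin p) ℝ)
    (C : (Fin p → ℝ) → Matrix (Fin q) (Fin d) ℝ)
    (D : (Fin p → ℝ) → Matrix (Fin q) (Fin p) ℝ)
    (U : Matrix S (Fin q) ℝ) (V : Matrix (Fin p) S ℝ)
    (x0 : Fin d → ℝ) (u1 : Fin p → ℝ) (T : ℕ) (z : ℕ → S) : ℝ :=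
  ∏ t ∈ Finset.range T,
    softmaxF (U.mulVec
      ((C (ssmState A B V x0 u1 z t).2).mulVec (ssmState A B V x0 u1 z t).1
        + (D (ssmState A B V x0 u1 z t).2).mulVec (ssmState A B V x0 u1 z t).2)) (z t)

/-- A time-invariant ISAN given by linear maps on a space `W` of dimension `n` can be written
in coordinates: in terms of matrices on `Fin n → ℝ`. -/
theorem exists_tvState_eq_of_linear {S W : Type*} [AddCommGroup W] [Module ℝ W]
    [Module.Finite ℝ W] [Module.Free ℝ W] {n : ℕ} (hn : Module.finrank ℝ W = n)
    (F : S → W →ₗ[ℝ] W) (G : W →ₗ[ℝ] S → ℝ) (w0 : W) :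
    ∃ (A' : S → Matrix (Fin n) (Fin n) ℝ) (B' : Matrix S (Fin n) ℝ) (x0' : Fin n → ℝ),
      ∀ (z : ℕ → S) (w : ℕ → W), w 0 = w0 → (∀ t, w (t + 1) = F (z t) (w t)) →
        ∀ t, B'.mulVec (tvState (fun s _ => A' s) x0' z t) = G (w t) := by
  obtain ⟨e⟩ : Nonempty (W ≃ₗ[ℝ] (Fin n → ℝ)) :=
    FiniteDimensional.nonempty_linearEquiv_of_finrank_eq (by simpa using hn)
  refine ⟨fun s => LinearMap.toMatrix' (e.toLinearMap ∘ₗ F s ∘ₗ e.symm.toLinearMap),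
    LinearMap.toMatrix' (G ∘ₗ e.symm.toLinearMap), e w0, fun z w h0 hw t => ?_⟩
  have key : ∀ t, tvState (fun s _ => LinearMap.toMatrix'
      (e.toLinearMap ∘ₗ F s ∘ₗ e.symm.toLinearMap)) (e w0) z t = e (w t) := by
    intro t
    induction t with
    | zero => simp [tvState, h0]
    | succ t ih => simp [tvState, ih, hw, LinearMap.toMatrix'_mulVec]
  simp [key, LinearMap.toMatrix'_mulVec]

/-- For a fixed input `u`, the linear map sending `(x, y, r, c)` to
`(a x + c b u, m x + c k u, 0, c)`; the entry `c = 1` makes affine updates linear, and the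
entry `r` is padding. -/
def homogenizedStep {p q d : ℕ} (a : Matrix (Fin d) (Fin d) ℝ) (b : Matrix (Fin d) (Fin p) ℝ)
    (m : Matrix (Fin q) (Fin d) ℝ) (k : Matrix (Fin q) (Fin p) ℝ) (u : Fin p → ℝ) :
    ((Fin d → ℝ) × (Fin q → ℝ) × (Fin q → ℝ) × ℝ) →ₗ[ℝ]
      ((Fin d → ℝ) × (Fin q → ℝ) × (Fin q → ℝ) × ℝ) where
  toFun w := (a.mulVec w.1 + w.2.2.2 • b.mulVec u, m.mulVec w.1 + w.2.2.2 • k.mulVec u,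
    0, w.2.2.2)
  map_add' v w := by
    ext <;> simp [Matrix.mulVec_add, add_smul] <;> ring
  map_smul' c w := by
    ext <;> simp [Matrix.mulVec_smul] <;> ring

/-- every linear-in-state SSM with input, output and hidden dimensions
`p, q, d` can be expressed as a (time-invariant) ISAN with hidden dimension
`d + 2q + 1` generating the same distribution over token sequences. -/
theorem stmt_10 {S : Type*} [Fintype S] [DecidableEq S] (p q d : ℕ)
    (A : (Fin p → ℝ) → Matrix (Fin d) (Fin d) ℝ)
    (B : (Fin p → ℝ) → Matrix (Fin d) (Fin p) ℝ)
    (C : (Fin p → ℝ) → Matrix (Fin q) (Fin d) ℝ)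
    (D : (Fin p → ℝ) → Matrix (Fin q) (Fin p) ℝ)
    (U : Matrix S (Fin q) ℝ) (V : Matrix (Fin p) S ℝ)
    (x0 : Fin d → ℝ) (u1 : Fin p → ℝ) :
    ∃ (A' : S → Matrix (Fin (d + 2 * q + 1)) (Fin (d + 2 * q + 1)) ℝ)
      (B' : Matrix S (Fin (d + 2 * q + 1)) ℝ) (x0' : Fin (d + 2 * q + 1) → ℝ),
      ∀ (T : ℕ) (z : ℕ → S),
        ssmProb A B C D U V x0 u1 T z
          = tvProb T (fun s _ => A' s) (fun _ => B') x0' z := by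
  obtain ⟨A', B', x0', h⟩ := exists_tvState_eq_of_linear
    (W := (Fin d → ℝ) × (Fin q → ℝ) × (Fin q → ℝ) × ℝ) (n := d + 2 * q + 1)
    (by simp; ring)
    (fun s : S =>
      let u := V.mulVec (oneHot s)
      homogenizedStep (A u) (B u) (C u) (D u) u)
    (U.mulVecLin ∘ₗ LinearMap.fst ℝ _ _ ∘ₗ LinearMap.snd ℝ _ _)
    ((A u1).mulVec x0 + (B u1).mulVec u1, (C u1).mulVec x0 + (D u1).mulVec u1, 0, 1)
  refine ⟨A', B', x0', fun T z => Finset.prod_congr rfl fun t _ => ?_⟩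
  -- The ISAN state stores the *next* hidden state and the current output of the layer.
  let σ := ssmState A B V x0 u1 z
  rw [h z (fun t => ((σ (t + 1)).1,
    (C (σ t).2).mulVec (σ t).1 + (D (σ t).2).mulVec (σ t).2, 0, 1)) rfl
    (fun t => by simp [σ, homogenizedStep, ssmState]) t]
  rfl
end

section
/- For every n ∈ ℕ and every ε > 0, there exists a time-varying ISAN of sequence length 2n over alphabet {0,1} with hidden dimension n + 1 whose generated distribution over {0,1}^{2n} is within total variation distance ε of the n-bit copying distribution. -/
/-- The `n`-bit copying distribution on `{0,1}^{2n}`: uniform over sequences of the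
form `a ∘ a` with `a ∈ {0,1}^n`. -/
noncomputable def copyDist (n : ℕ) (w : Fin (2 * n) → Bool) : ℝ :=
  if ∀ i : Fin n, w ⟨(i : ℕ), by have := i.isLt; omega⟩
      = w ⟨n + (i : ℕ), by have := i.isLt; omega⟩
    then (1 : ℝ) / 2 ^ n else 0

open Filter Topology

/-- The sign encoding a bit: `1` for `true`, `-1` for `false`. -/
noncomputable def bitSign (b : Bool) : ℝ := if b then 1 else -1

/-- Transition matrices writing the sign of the bit read at time `t < n` into coordinate `t`. -/
noncomputable def copyTransition (n : ℕ) (b : Bool) (t : ℕ) :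
    Matrix (Fin (n + 1)) (Fin (n + 1)) ℝ :=
  1 + if h : t < n then Matrix.single ⟨t, by omega⟩ (Fin.last n) (bitSign b) else 0

/-- Output matrices reading coordinate `t - n` at time `t`, scaled by `M`. -/
noncomputable def copyOutput (n : ℕ) (M : ℝ) (t : ℕ) : Matrix Bool (Fin (n + 1)) ℝ :=
  fun b j => if b = true ∧ t = n + j then M else 0

theorem tvState_copyTransition (n : ℕ) (z : ℕ → Bool) (t : ℕ) (j : Fin (n + 1)) :
    tvState (copyTransition n) (Pi.single (Fin.last n) 1) z t j =
      if (j : ℕ) = n then 1 else if (j : ℕ) < t then bitSign (z j) else 0 := by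
  induction t generalizing j with
  | zero => simp [tvState, Pi.single_apply, Fin.ext_iff]
  | succ t ih =>
    rw [tvState, copyTransition, Matrix.add_mulVec, Matrix.one_mulVec, Pi.add_apply, ih]
    split_ifs <;>
      simp only [Matrix.single_mulVec, Matrix.zero_mulVec, Pi.zero_apply, Function.update_apply,
        Fin.ext_iff, ih, Fin.val_last] <;> grind

theorem copyOutput_mulVec (n : ℕ) (M : ℝ) (x : Fin (n + 1) → ℝ) (i : Fin n) :
    (copyOutput n M (n + i)).mulVec x = fun b => if b then M * x i.castSucc else 0 := by
  ext b
  cases b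
  · simp [Matrix.mulVec, dotProduct, copyOutput]
  · have : ∀ j : Fin (n + 1), (i : ℕ) = j ↔ i.castSucc = j := fun j => by simp [Fin.ext_iff]
    simp [Matrix.mulVec, dotProduct, copyOutput, this]

theorem copyOutput_eq_zero (n : ℕ) (M : ℝ) {t : ℕ} (ht : t < n) : copyOutput n M t = 0 := by
  ext b j
  simp only [copyOutput, Matrix.zero_apply, ite_eq_right_iff]
  omega

theorem tvProb_copy (n : ℕ) (M : ℝ) (z : ℕ → Bool) :
    tvProb (2 * n) (copyTransition n) (copyOutput n M) (Pi.single (Fin.last n) 1) z =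
      (1 / 2) ^ n * ∏ i : Fin n,
        softmaxF (fun b : Bool => if b then M * bitSign (z i) else 0) (z (n + i)) := by
  rw [tvProb, two_mul, Finset.prod_range_add]
  congr 1
  · rw [Finset.prod_congr rfl (g := fun _ => (1 / 2 : ℝ)), Finset.prod_const, Finset.card_range]
    intro t ht
    rw [copyOutput_eq_zero n M (Finset.mem_range.1 ht), Matrix.zero_mulVec]
    norm_num [softmaxF]
  · rw [Finset.prod_range]
    refine Finset.prod_congr rfl fun i _ => ?_
    have hi := i.isLt
    rw [copyOutput_mulVec, tvState_copyTransition, Fin.val_castSucc, if_neg hi.ne,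
      if_pos (by omega)]

theorem tendsto_softmaxF_bitSign (a b : Bool) :
    Tendsto (fun M : ℝ => softmaxF (fun c : Bool => if c then M * bitSign a else 0) b) atTop
      (𝓝 (if a = b then 1 else 0)) := by
  have h₀ : Tendsto (fun M : ℝ => Real.exp (-M)) atTop (𝓝 0) :=
    Real.tendsto_exp_neg_atTop_nhds_zero
  have h₁ : Tendsto (fun M : ℝ => 1 / (Real.exp (-M) + 1)) atTop (𝓝 1) := by
    simpa [Pi.div_def] using (tendsto_const_nhds (x := (1 : ℝ))).div (h₀.add_const 1) (by norm_num)
  have h₂ : Tendsto (fun M : ℝ => Real.exp (-M) / (Real.exp (-M) + 1)) atTop (𝓝 0) := by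
    simpa [Pi.div_def] using h₀.div (h₀.add_const 1) (by norm_num)
  have h (M : ℝ) : Real.exp M * Real.exp (-M) = 1 := by simp [← Real.exp_add]
  cases a <;> cases b <;> simp only [softmaxF, bitSign, Fintype.sum_bool]
  · simpa using h₁
  · simpa using h₂
  · refine (h₂.congr fun M => ?_).trans_eq (by simp)
    have := h M
    simp
    field_simp
    linear_combination this
  · refine (h₁.congr fun M => ?_).trans_eq (by simp)
    have := h M
    simp
    field_simp
    linear_combination -this

theorem tendsto_tvProb_copy (n : ℕ) (w : Fin (2 * n) → Bool) :
    Tendsto (fun M : ℝ => tvProb (2 * n) (copyTransition n) (copyOutput n M)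
      (Pi.single (Fin.last n) 1) (fun k => if h : k < 2 * n then w ⟨k, h⟩ else false)) atTop
      (𝓝 (copyDist n w)) := by
  simp only [tvProb_copy]
  have h := (tendsto_finsetProd (Finset.univ : Finset (Fin n)) fun i _ =>
    tendsto_softmaxF_bitSign (w ⟨i, by omega⟩) (w ⟨n + i, by omega⟩)).const_mul ((1 / 2 : ℝ) ^ n)
  convert h using 2
  · refine congrArg _ (Finset.prod_congr rfl fun i _ => ?_)
    rw [dif_pos (by omega), dif_pos (by omega)]
  · rw [copyDist, Finset.prod_ite_zero]
    simp

/-- for every `n` and `ε > 0` there is a time-varying ISAN of sequence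
length `2n` over `{0,1}` with hidden dimension `n + 1` whose generated distribution is
within total variation distance `ε` of the `n`-bit copying distribution. -/
theorem stmt_11 (n : ℕ) (ε : ℝ) (hε : 0 < ε) :
    ∃ (A : Bool → ℕ → Matrix (Fin (n + 1)) (Fin (n + 1)) ℝ)
      (B : ℕ → Matrix Bool (Fin (n + 1)) ℝ) (x0 : Fin (n + 1) → ℝ),
      (1 / 2) * ∑ w : Fin (2 * n) → Bool,
          |tvProb (2 * n) A B x0 (fun k => if h : k < 2 * n then w ⟨k, h⟩ else false)
            - copyDist n w| ≤ ε := by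
  have h := (tendsto_finsetSum (Finset.univ : Finset (Fin (2 * n) → Bool)) fun w _ =>
    ((tendsto_tvProb_copy n w).sub_const (copyDist n w)).abs).const_mul (1 / 2 : ℝ)
  simp only [sub_self, abs_zero, Finset.sum_const_zero, mul_zero] at h
  obtain ⟨M, hM⟩ := (h.eventually_le_const hε).exists
  exact ⟨copyTransition n, copyOutput n M, Pi.single (Fin.last n) 1, hM⟩
end

section
/- For every noisy parity distribution over {0,1}^{n+1} (with hidden vector y ∈ {0,1}^n and noise probability p ∈ (0, 1/2)), there exists a time-varying ISAN of sequence length n + 1 over alphabet {0,1} with hidden dimension 2 that generates exactly this distribution. -/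
/-- Parity `⟨y, z⟩ mod 2` of the AND of two bit-vectors. -/
def parityInner {n : ℕ} (y z : Fin n → Bool) : Bool :=
  decide ((Finset.univ.filter fun i => y i && z i).card % 2 = 1)

/-- The noisy parity distribution on `{0,1}^{n+1}` with hidden vector `y` and noise
probability `p`: the first `n` bits are uniform and the last bit equals the parity
`⟨y, z⟩ mod 2` with probability `1 - p`. -/
noncomputable def noisyParity {n : ℕ} (y : Fin n → Bool) (p : ℝ)
    (w : Fin (n + 1) → Bool) : ℝ :=
  ((1 : ℝ) / 2 ^ n) *
    (if w (Fin.last n) = parityInner y (fun i => w i.castSucc) then 1 - p else p)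

/-- With scalar transition matrices the hidden state is a scalar multiple of the initial one. -/
theorem tvState_smul_one {S : Type*} {d : ℕ} (a : S → ℕ → ℝ) (x0 : Fin d → ℝ) (z : ℕ → S)
    (t : ℕ) :
    tvState (fun s k => a s k • (1 : Matrix (Fin d) (Fin d) ℝ)) x0 z t
      = (∏ k ∈ Finset.range t, a (z k) k) • x0 := by
  induction t with
  | zero => simp [tvState]
  | succ t ih =>
    simp only [tvState, ih, Matrix.smul_mulVec, Matrix.one_mulVec, Finset.prod_range_succ,
      smul_smul, mul_comm]

theorem prod_sign_eq_parityInner {n : ℕ} (y z : Fin n → Bool) :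
    ∏ i, (if y i && z i then (-1 : ℝ) else 1) = if parityInner y z then -1 else 1 := by
  rw [Finset.prod_ite, Finset.prod_const, Finset.prod_const_one, mul_one, parityInner]
  rcases Nat.mod_two_eq_zero_or_one (Finset.univ.filter fun i => y i && z i).card with h | h
  · rw [(Nat.even_iff.2 h).neg_one_pow, h]
    simp
  · rw [(Nat.odd_iff.2 h).neg_one_pow, h]
    simp

theorem softmaxF_zero_bool (b : Bool) : softmaxF (0 : Bool → ℝ) b = 1 / 2 := by
  norm_num [softmaxF]

/-- Softmax of the logits `∓ log ((1 - p) / p) / 2`, whose sign is given by the bit `c`. -/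
theorem softmaxF_signed_logit {p : ℝ} (hp0 : 0 < p) (hp1 : p < 1) (b c : Bool) :
    softmaxF (fun b' : Bool => (if b' then (-1 : ℝ) else 1) * (Real.log ((1 - p) / p) / 2) *
      (if c then -1 else 1)) b = if b = c then 1 - p else p := by
  have hq : 0 < 1 - p := by linarith
  set l := Real.log ((1 - p) / p) / 2 with hl
  have hpos := Real.exp_pos (-l)
  have h : Real.exp l * p = (1 - p) * Real.exp (-l) := by
    have h2 : Real.exp l = (1 - p) / p * Real.exp (-l) := by
      rw [← Real.exp_log (div_pos hq hp0), ← Real.exp_add, hl]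
      ring_nf
    rw [h2]
    field_simp
  have hpos' := Real.exp_pos l
  cases b <;> cases c <;> simp only [softmaxF, Fintype.sum_bool] <;> simp <;>
    rw [div_eq_iff (by positivity)] <;> linarith

/-- every noisy parity distribution on `{0,1}^{n+1}` (hidden vector `y`,
noise probability `p ∈ (0, 1/2)`) is exactly generated by a time-varying ISAN of
sequence length `n + 1` with hidden dimension `2`. -/
theorem stmt_12 (n : ℕ) (y : Fin n → Bool) (p : ℝ) (hp0 : 0 < p) (hp1 : p < 1 / 2) :
    ∃ (A : Bool → ℕ → Matrix (Fin 2) (Fin 2) ℝ) (B : ℕ → Matrix Bool (Fin 2) ℝ)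
      (x0 : Fin 2 → ℝ),
      ∀ w : Fin (n + 1) → Bool,
        tvProb (n + 1) A B x0 (fun k => if h : k < n + 1 then w ⟨k, h⟩ else false)
          = noisyParity y p w := by
  refine ⟨fun s k => (if h : k < n then (if y ⟨k, h⟩ && s then (-1 : ℝ) else 1) else 1) • 1,
    fun t => if t < n then 0 else
      Matrix.of fun b j => if j = 0 then
        (if b then (-1 : ℝ) else 1) * (Real.log ((1 - p) / p) / 2) else 0,
    fun _ => 1, fun w => ?_⟩
  rw [tvProb, Finset.prod_range_succ, noisyParity]
  congr 1
  · rw [Finset.prod_congr rfl (g := fun _ => (1 / 2 : ℝ)), Finset.prod_const]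
    · simp
    · intro t ht
      rw [if_pos (Finset.mem_range.1 ht), Matrix.zero_mulVec, softmaxF_zero_bool]
  · rw [tvState_smul_one (fun s k => if h : k < n then
      (if y ⟨k, h⟩ && s then (-1 : ℝ) else 1) else 1), Finset.prod_range]
    have hsign : ∏ i : Fin n, (if h : (i : ℕ) < n then
        (if y ⟨i, h⟩ && (if h : (i : ℕ) < n + 1 then w ⟨i, h⟩ else false) then (-1 : ℝ) else 1)
        else 1) = if parityInner y (fun i => w i.castSucc) then -1 else 1 := by
      rw [← prod_sign_eq_parityInner]
      refine Finset.prod_congr rfl fun i _ => ?_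
      rw [dif_pos i.isLt, dif_pos (i.isLt.trans n.lt_succ_self)]
      rfl
    rw [hsign, if_neg (lt_irrefl n), dif_pos n.lt_succ_self]
    refine Eq.trans ?_ (softmaxF_signed_logit hp0 (by linarith) (w (Fin.last n)) _)
    congr 1
    funext b
    simp [Matrix.mulVec, dotProduct]
end

section
/- Let M be the noisy parity distribution over {0,1}^{n+1} with hidden vector y ∈ {0,1}^n and noise probability p ∈ (0, 1/2), viewed as a language model over sequences of length n+1 with alphabet Σ = {0,1}. Then for every t ∈ {0, 1, …, n+1}, the extended logit matrix L_M({0,1}^t, {0,1}^{≤n+1−t}) has rank at most 2; in particular, this matrix has at most two distinct rows, determined by the parity of the inner product of the first t bits with the first t bits of y. -/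
/-- The parity of the inner product of a length-`t` history with the first `t` bits
of the hidden vector `y` (indices beyond `n` are ignored). -/
def parityPrefix {n t : ℕ} (y : Fin n → Bool) (h : Fin t → Bool) : Bool :=
  decide ((Finset.univ.filter fun i : Fin t =>
    if hi : (i : ℕ) < n then y ⟨(i : ℕ), hi⟩ && h i else false).card % 2 = 1)

/-- A matrix whose rows depend only on a `κ`-valued label of the row index has rank at most
the cardinality of `κ`. -/
theorem Matrix.rank_le_card_of_row_factorsThrough {H C κ : Type*} [Fintype C] [Fintype κ]
    [DecidableEq κ] (A : Matrix H C ℝ) (label : H → κ)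
    (hA : ∀ h h', label h = label h' → ∀ c, A h c = A h' c) :
    A.rank ≤ Fintype.card κ := by
  have hfac : Function.FactorsThrough A label := fun h h' e => funext (hA h h' e)
  have hmul : A = (Matrix.of fun h b => if label h = b then (1 : ℝ) else 0) *
      (Matrix.of (Function.extend label A 0)) := by
    ext h c
    simp [Matrix.mul_apply, hfac.extend_apply]
  rw [hmul]
  exact (Matrix.rank_mul_le_left _ _).trans (Matrix.rank_le_card_width _)

/-- Overwrite the first `t` entries of `w` by `h`. -/
def overwritePrefix {S : Type*} {T t : ℕ} (h : Fin t → S) (w : Fin T → S) : Fin T → S :=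
  fun i => if hi : (i : ℕ) < t then h ⟨i, hi⟩ else w i

theorem take_ofFn_eq_append_iff {S : Type*} {T t : ℕ} (ht : t ≤ T) (h : Fin t → S)
    (w : Fin T → S) (s : List S) :
    (List.ofFn w).take (List.ofFn h ++ s).length = List.ofFn h ++ s ↔
      (∀ i : Fin t, w (Fin.castLE ht i) = h i) ∧
        ((List.ofFn w).drop t).take s.length = s := by
  have htake : (List.ofFn w).take t = List.ofFn fun i : Fin t => w (Fin.castLE ht i) := by
    apply List.ext_getElem
    · simp [ht]
    · intro i h₁ h₂
      simp
  rw [List.length_append, List.length_ofFn, List.take_add, htake,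
    List.append_eq_append_iff_of_size_eq_left (by simp), List.ofFn_inj, funext_iff]

theorem drop_ofFn_overwritePrefix {S : Type*} {T t : ℕ} (h : Fin t → S) (w : Fin T → S) :
    (List.ofFn (overwritePrefix h w)).drop t = (List.ofFn w).drop t := by
  apply List.ext_getElem
  · simp
  · intro i h₁ h₂
    simp [overwritePrefix]

theorem overwritePrefix_castLE {S : Type*} {T t : ℕ} (ht : t ≤ T) (h : Fin t → S)
    (w : Fin T → S) (i : Fin t) : overwritePrefix h w (Fin.castLE ht i) = h i := by
  simp [overwritePrefix]

theorem overwritePrefix_overwritePrefix {S : Type*} {T t : ℕ} (ht : t ≤ T) (h h' : Fin t → S)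
    (w : Fin T → S) (hw : ∀ i : Fin t, w (Fin.castLE ht i) = h i) :
    overwritePrefix h (overwritePrefix h' w) = w := by
  funext i
  by_cases hi : (i : ℕ) < t
  · simpa [overwritePrefix, hi] using (hw ⟨i, hi⟩).symm
  · simp [overwritePrefix, hi]

/-- If overwriting the prefix `h` by `h'` preserves the mass of every sequence starting with `h`,
then `h` and `h'` are interchangeable as beginnings of prefixes. -/
theorem prefProb_append_congr {S : Type*} [Fintype S] [DecidableEq S] {T t : ℕ} (ht : t ≤ T)
    (M : (Fin T → S) → ℝ) (h h' : Fin t → S)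
    (hM : ∀ w : Fin T → S, (∀ i : Fin t, w (Fin.castLE ht i) = h i) →
      M w = M (overwritePrefix h' w)) (s : List S) :
    prefProb M (List.ofFn h ++ s) = prefProb M (List.ofFn h' ++ s) := by
  unfold prefProb
  simp only [take_ofFn_eq_append_iff ht]
  refine Finset.sum_nbij' (overwritePrefix h') (overwritePrefix h) ?_ ?_ ?_ ?_ ?_
  · intro w hw
    simp only [Finset.mem_filter, Finset.mem_univ, true_and] at hw ⊢
    exact ⟨overwritePrefix_castLE ht h' w, by rw [drop_ofFn_overwritePrefix]; exact hw.2⟩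
  · intro w hw
    simp only [Finset.mem_filter, Finset.mem_univ, true_and] at hw ⊢
    exact ⟨overwritePrefix_castLE ht h w, by rw [drop_ofFn_overwritePrefix]; exact hw.2⟩
  · intro w hw
    exact overwritePrefix_overwritePrefix ht h h' w (Finset.mem_filter.1 hw).2.1
  · intro w hw
    exact overwritePrefix_overwritePrefix ht h' h w (Finset.mem_filter.1 hw).2.1
  · intro w hw
    exact hM w (Finset.mem_filter.1 hw).2.1

theorem prefProb_eq_zero_of_length_lt {S : Type*} [Fintype S] [DecidableEq S] {T : ℕ}
    (M : (Fin T → S) → ℝ) (l : List S) (hl : T < l.length) : prefProb M l = 0 := by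
  unfold prefProb
  rw [Finset.filter_false_of_mem, Finset.sum_empty]
  intro w _ hw
  have := congrArg List.length hw
  simp at this
  omega

theorem mcLogit_eq_zero_of_length_le {S : Type*} [Fintype S] [DecidableEq S] {T : ℕ}
    (M : (Fin T → S) → ℝ) (l : List S) (hl : T ≤ l.length) (z : S) : mcLogit M l z = 0 := by
  have hc : ∀ z, condProb M l z = 0 := fun z => by
    rw [condProb, prefProb_eq_zero_of_length_lt M _ (by simp; omega), zero_div]
  simp [mcLogit, hc]

/-- The inner product splits into the contributions of the first `t` and the remaining bits. -/
theorem card_inner_eq_prefix_add {t m : ℕ} (y : Fin (t + m) → Bool) (h : Fin t → Bool)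
    (v : Fin (t + m) → Bool) (hv : ∀ i : Fin t, v (Fin.castAdd m i) = h i) :
    (Finset.univ.filter fun i => y i && v i).card =
      (Finset.univ.filter fun i : Fin t =>
        if hi : (i : ℕ) < t + m then y ⟨(i : ℕ), hi⟩ && h i else false).card +
      (Finset.univ.filter fun j : Fin m =>
        y (Fin.natAdd t j) && v (Fin.natAdd t j)).card := by
  simp only [Finset.card_filter, Fin.sum_univ_add, hv]
  congr 1
  refine Finset.sum_congr rfl fun i _ => ?_
  have hi : (i : ℕ) < t + m := by omega
  simp only [hi, dif_pos]
  rfl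

theorem noisyParity_overwritePrefix {t m : ℕ} (y : Fin (t + m) → Bool) (p : ℝ)
    (h h' : Fin t → Bool) (hpar : parityPrefix y h = parityPrefix y h')
    (ht : t ≤ t + m + 1) (w : Fin (t + m + 1) → Bool)
    (hw : ∀ i : Fin t, w (Fin.castLE ht i) = h i) :
    noisyParity y p w = noisyParity y p (overwritePrefix h' w) := by
  have hlast : overwritePrefix h' w (Fin.last (t + m)) = w (Fin.last (t + m)) := by
    simp [overwritePrefix]
  have hinner : parityInner y (fun i => w i.castSucc) =
      parityInner y (fun i => overwritePrefix h' w i.castSucc) := by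
    unfold parityPrefix at hpar
    unfold parityInner
    rw [card_inner_eq_prefix_add y h _ hw,
      card_inner_eq_prefix_add y h' _ (overwritePrefix_castLE ht h' w)]
    have htail : ∀ j : Fin m, overwritePrefix h' w (Fin.natAdd t j).castSucc =
        w (Fin.natAdd t j).castSucc := fun j => by
      simp [overwritePrefix]
    simp only [htail]
    rw [decide_eq_decide] at hpar ⊢
    omega
  rw [noisyParity, noisyParity, hlast, hinner]

theorem mcLogit_noisyParity_append_congr {n t : ℕ} (ht : t ≤ n) (y : Fin n → Bool) (p : ℝ)
    (h h' : Fin t → Bool) (hpar : parityPrefix y h = parityPrefix y h') (s : List Bool)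
    (z : Bool) :
    mcLogit (noisyParity y p) (List.ofFn h ++ s) z =
      mcLogit (noisyParity y p) (List.ofFn h' ++ s) z := by
  obtain ⟨m, rfl⟩ := Nat.exists_eq_add_of_le ht
  have hpref := prefProb_append_congr (by omega) (noisyParity y p) h h'
    (noisyParity_overwritePrefix y p h h' hpar _)
  simp only [mcLogit, condProb, List.append_assoc, hpref]

/-- for the noisy parity distribution `M` on `{0,1}^{n+1}`, for every
`t ∈ {0, …, n+1}` the extended logit matrix `L_M({0,1}^t, {0,1}^{≤ n+1−t})` has rank at
most `2`; in particular it has at most two distinct rows, determined by the parity of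
the inner product of the first `t` bits with the first `t` bits of `y`. -/
theorem stmt_13 (n : ℕ) (y : Fin n → Bool) (p : ℝ) (hp0 : 0 < p) (hp1 : p < 1 / 2) :
    ∀ t : ℕ, t ≤ n + 1 →
      (logitMatrix (noisyParity y p) (fun h : Fin t → Bool => List.ofFn h)
          (fun f : (j : Fin (n + 1 - t + 1)) × (Fin (j : ℕ) → Bool) =>
            List.ofFn f.2)).rank ≤ 2
      ∧ ∀ h h' : Fin t → Bool, parityPrefix y h = parityPrefix y h' →
          ∀ c, logitMatrix (noisyParity y p) (fun h : Fin t → Bool => List.ofFn h)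
              (fun f : (j : Fin (n + 1 - t + 1)) × (Fin (j : ℕ) → Bool) =>
                List.ofFn f.2) h c
            = logitMatrix (noisyParity y p) (fun h : Fin t → Bool => List.ofFn h)
              (fun f : (j : Fin (n + 1 - t + 1)) × (Fin (j : ℕ) → Bool) =>
                List.ofFn f.2) h' c := by
  intro t ht
  have hrows : ∀ h h' : Fin t → Bool, parityPrefix y h = parityPrefix y h' →
      ∀ c, logitMatrix (noisyParity y p) (fun h : Fin t → Bool => List.ofFn h)
          (fun f : (j : Fin (n + 1 - t + 1)) × (Fin (j : ℕ) → Bool) => List.ofFn f.2) h c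
        = logitMatrix (noisyParity y p) (fun h : Fin t → Bool => List.ofFn h)
          (fun f : (j : Fin (n + 1 - t + 1)) × (Fin (j : ℕ) → Bool) => List.ofFn f.2) h' c := by
    intro h h' hpar c
    simp only [logitMatrix, Matrix.of_apply]
    rcases Nat.lt_or_ge n t with hnt | hnt
    · rw [mcLogit_eq_zero_of_length_le _ _ (by simp; omega),
        mcLogit_eq_zero_of_length_le _ _ (by simp; omega)]
    · exact mcLogit_noisyParity_append_congr hnt y p h h' hpar _ _
  refine ⟨?_, hrows⟩
  simpa using Matrix.rank_le_card_of_row_factorsThrough _ (parityPrefix y) hrows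
end

section
/- Let M be a language model over a finite alphabet Σ, h_0 ∈ Σ* a target history, and H = {h_1,…,h_n} ⊂ Σ* a set of basis histories; let H_0 = H ∪ {h_0}. Let P_1 be the distribution over futures obtained by drawing t uniformly from {0,1,…,k−1} and then a uniformly random sequence from Σ^t, and let P_2 be the distribution obtained by drawing t uniformly from {0,1,…,k−1} and then sampling a length-t continuation of h_0 according to M. Suppose that for parameters α, γ ≥ 0: E_{f∼P_2}[L_M(H_0,{f}) L_M(H_0,{f})ᵀ] ⪯ α · E_{f∼P_1}[L_M(H_0,{f}) L_M(H_0,{f})ᵀ] + γ I_{n+1}. Then for any vector v ∈ ℝ^n with E_{f∼P_1}[‖L_M({h_0},{f}) − vᵀ L_M(H,{f})‖²] ≤ Δ, letting P_LinGen be the distribution of LinGen(v, H, k) and P_truth the distribution of length-k continuations of h_0 under M, it holds that KL(P_truth ‖ P_LinGen) ≤ 2k · sqrt(α·Δ + γ·(1 + ‖v‖²)). -/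
open Matrix

/-- Mean-centered next-token logits `L_M[z ∣ y]` of a language model `M` which assigns
to every history `y ∈ Σ*` a next-token distribution `M y`. -/
noncomputable def nextLogit {S : Type*} [Fintype S] (M : List S → S → ℝ)
    (y : List S) (z : S) : ℝ :=
  Real.log (M y z) - (1 / (Fintype.card S : ℝ)) * ∑ z', Real.log (M y z')

/-- The `|H| × |Σ|` logit matrix `L_M(H, {f})` for a family of histories `hs` and a
single future `f`. -/
noncomputable def logitMat {S : Type*} [Fintype S] {ι : Type*} (M : List S → S → ℝ)
    (hs : ι → List S) (f : List S) : Matrix ι S ℝ :=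
  Matrix.of fun i z => nextLogit M (hs i ++ f) z

/-- The second-moment matrix `L_M(H,{f}) L_M(H,{f})ᵀ`. -/
noncomputable def sqMoment {S : Type*} [Fintype S] {ι : Type*} (M : List S → S → ℝ)
    (hs : ι → List S) (f : List S) : Matrix ι ι ℝ :=
  logitMat M hs f * (logitMat M hs f)ᵀ

/-- Probability under `M` of generating the continuation `f` after the history `h`. -/
noncomputable def contProb {S : Type*} (M : List S → S → ℝ) (h : List S) {t : ℕ}
    (f : Fin t → S) : ℝ :=
  ∏ i : Fin t, M (h ++ (List.ofFn f).take (i : ℕ)) (f i)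

/-- `E_{f ∼ P₁}[L_M(H,{f}) L_M(H,{f})ᵀ]` where `P₁` draws `t` uniformly from
`{0, …, k−1}` and then a uniformly random future in `Σ^t`. -/
noncomputable def unifMoment {S : Type*} [Fintype S] {ι : Type*} (M : List S → S → ℝ)
    (hs : ι → List S) (k : ℕ) : Matrix ι ι ℝ :=
  Matrix.of fun a b => (1 / (k : ℝ)) * ∑ t ∈ Finset.range k,
    ((1 : ℝ) / (Fintype.card S : ℝ) ^ t) * ∑ f : Fin t → S,
      sqMoment M hs (List.ofFn f) a b

/-- `E_{f ∼ P₂}[L_M(H,{f}) L_M(H,{f})ᵀ]` where `P₂` draws `t` uniformly from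
`{0, …, k−1}` and then a length-`t` continuation of `h0` according to `M`. -/
noncomputable def modelMoment {S : Type*} [Fintype S] {ι : Type*} (M : List S → S → ℝ)
    (hs : ι → List S) (h0 : List S) (k : ℕ) : Matrix ι ι ℝ :=
  Matrix.of fun a b => (1 / (k : ℝ)) * ∑ t ∈ Finset.range k,
    ∑ f : Fin t → S, contProb M h0 f * sqMoment M hs (List.ofFn f) a b

/-- The distribution of length-`k` continuations of `h0` under `M`. -/
noncomputable def truthProb {S : Type*} (M : List S → S → ℝ) (h0 : List S) (k : ℕ)
    (w : Fin k → S) : ℝ :=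
  ∏ t : Fin k, M (h0 ++ (List.ofFn w).take (t : ℕ)) (w t)

/-- The distribution of `LinGen(v, H, k)`: the token `z_t` is sampled from
`softmax (Σ_h v_h · L_M[· ∣ h ∘ z_{1:t−1}])`. -/
noncomputable def lingenProb {S : Type*} [Fintype S] {n : ℕ} (M : List S → S → ℝ)
    (hs : Fin n → List S) (v : Fin n → ℝ) (k : ℕ) (w : Fin k → S) : ℝ :=
  ∏ t : Fin k,
    softmaxF (fun z => ∑ i, v i * nextLogit M (hs i ++ (List.ofFn w).take (t : ℕ)) z)
      (w t)

/-- KL divergence between two distributions on `Σ^k`. -/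
noncomputable def klSeq {S : Type*} [Fintype S] (k : ℕ) (P Q : (Fin k → S) → ℝ) : ℝ :=
  ∑ w : Fin k → S, P w * Real.log (P w / Q w)

lemma List.take_ofFn_snoc {S : Type*} {m : ℕ} (f : Fin m → S) (z : S) {i : ℕ} (hi : i ≤ m) :
    (List.ofFn (Fin.snoc f z : Fin (m + 1) → S)).take i = (List.ofFn f).take i := by
  have h : List.ofFn (Fin.snoc f z : Fin (m + 1) → S) = List.ofFn f ++ [z] := by
    rw [List.ofFn_succ_last]
    simp
  rw [h, List.take_append_of_le_length (by simpa using hi)]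

lemma contProb_snoc {S : Type*} (M : List S → S → ℝ) (h : List S) {m : ℕ}
    (f : Fin m → S) (z : S) :
    contProb M h (Fin.snoc f z : Fin (m + 1) → S)
      = contProb M h f * M (h ++ List.ofFn f) z := by
  unfold contProb
  rw [Fin.prod_univ_castSucc]
  congr 1
  · refine Finset.prod_congr rfl fun i _ => ?_
    simp only [Fin.val_castSucc, Fin.snoc_castSucc]
    rw [List.take_ofFn_snoc f z i.2.le]
  · simp only [Fin.val_last, Fin.snoc_last]
    rw [List.take_ofFn_snoc f z le_rfl, List.take_of_length_le (by simp)]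

lemma contProb_nonneg {S : Type*} {M : List S → S → ℝ} (hM : ∀ y z, 0 ≤ M y z) (h : List S)
    {t : ℕ} (f : Fin t → S) : 0 ≤ contProb M h f :=
  Finset.prod_nonneg fun _ _ => hM _ _

lemma sum_contProb_mul_take {S : Type*} [Fintype S] {M : List S → S → ℝ}
    (hsum : ∀ y, ∑ z, M y z = 1) (h : List S) (G : List S → ℝ) {t k : ℕ} (htk : t ≤ k) :
    ∑ w : Fin k → S, contProb M h w * G ((List.ofFn w).take t)
      = ∑ f : Fin t → S, contProb M h f * G (List.ofFn f) := by
  induction k, htk using Nat.le_induction with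
  | base =>
    refine Finset.sum_congr rfl fun f _ => ?_
    rw [List.take_of_length_le (by simp)]
  | succ m hm ih =>
    rw [← ih, ← (Fin.snocEquiv fun _ => S).sum_comp, Fintype.sum_prod_type, Finset.sum_comm]
    refine Finset.sum_congr rfl fun f _ => ?_
    simp only [Fin.snocEquiv, Equiv.coe_fn_mk, contProb_snoc, List.take_ofFn_snoc f _ hm]
    rw [← Finset.sum_mul, ← Finset.mul_sum, hsum, mul_one]

lemma sum_contProb {S : Type*} [Fintype S] {M : List S → S → ℝ}
    (hsum : ∀ y, ∑ z, M y z = 1) (h : List S) (t : ℕ) :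
    ∑ f : Fin t → S, contProb M h f = 1 := by
  have := sum_contProb_mul_take hsum h (fun _ => 1) (Nat.zero_le t)
  simpa [contProb] using this

/-- The log-likelihood ratio between a distribution and a softmax is at most twice the
uniform distance between the logits. -/
lemma log_div_softmaxF_le {S : Type*} [Fintype S] (M : List S → S → ℝ) (y : List S)
    (hpos : ∀ z, 0 < M y z) (hsum : ∑ z, M y z = 1) (b : S → ℝ) (D : ℝ)
    (hD : ∀ z, |nextLogit M y z - b z| ≤ D) (z : S) :
    Real.log (M y z / softmaxF b z) ≤ 2 * D := by
  obtain ⟨c, hexp⟩ : ∃ c, ∀ x, M y x = c * Real.exp (nextLogit M y x) := by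
    refine ⟨Real.exp ((1 / (Fintype.card S : ℝ)) * ∑ z', Real.log (M y z')), fun x => ?_⟩
    rw [← Real.exp_add, nextLogit, add_sub_cancel, Real.exp_log (hpos x)]
  have hc : 0 ≤ c := by
    have := hpos z
    rw [hexp] at this
    exact (pos_of_mul_pos_left this (Real.exp_pos _).le).le
  have hcZ : c * ∑ x, Real.exp (b x) ≤ Real.exp D := by
    calc c * ∑ x, Real.exp (b x) ≤ c * ∑ x, Real.exp D * Real.exp (nextLogit M y x) := by
          gcongr with x
          rw [← Real.exp_add, Real.exp_le_exp]
          linarith [(abs_le.mp (hD x)).1]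
      _ = Real.exp D * ∑ x, M y x := by
          simp only [hexp, Finset.mul_sum]
          exact Finset.sum_congr rfl fun x _ => by ring
      _ = Real.exp D := by rw [hsum, mul_one]
  have hratio : M y z / softmaxF b z
      = Real.exp (nextLogit M y z - b z) * (c * ∑ x, Real.exp (b x)) := by
    rw [softmaxF, hexp, Real.exp_sub, div_div_eq_mul_div]
    ring
  have hZ : 0 < ∑ x, Real.exp (b x) := Finset.sum_pos (fun _ _ => Real.exp_pos _) ⟨z, by simp⟩
  have hq : 0 < softmaxF b z := div_pos (Real.exp_pos _) hZ
  rw [Real.log_le_iff_le_exp (div_pos (hpos z) hq), hratio, two_mul, Real.exp_add]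
  exact mul_le_mul (Real.exp_le_exp.mpr (abs_le.mp (hD z)).2) hcZ
    (mul_nonneg hc hZ.le) (Real.exp_pos _).le

lemma dotProduct_sqMoment_mulVec {S ι : Type*} [Fintype S] [Fintype ι] (M : List S → S → ℝ)
    (hs : ι → List S) (f : List S) (u : ι → ℝ) :
    u ⬝ᵥ (sqMoment M hs f *ᵥ u) = ∑ z, (∑ i, u i * nextLogit M (hs i ++ f) z) ^ 2 := by
  rw [sqMoment, ← Matrix.mulVec_mulVec, Matrix.dotProduct_mulVec, Matrix.mulVec_transpose]
  simp [dotProduct, Matrix.vecMul, logitMat, sq]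

lemma unifMoment_eq_sum {S ι : Type*} [Fintype S] (M : List S → S → ℝ)
    (hs : ι → List S) (k : ℕ) :
    unifMoment M hs k = (1 / (k : ℝ)) • ∑ t ∈ Finset.range k,
      ((1 : ℝ) / (Fintype.card S : ℝ) ^ t) • ∑ f : Fin t → S, sqMoment M hs (List.ofFn f) := by
  ext a b
  simp [unifMoment, Matrix.sum_apply]

lemma modelMoment_eq_sum {S ι : Type*} [Fintype S] (M : List S → S → ℝ)
    (hs : ι → List S) (h0 : List S) (k : ℕ) :
    modelMoment M hs h0 k = (1 / (k : ℝ)) • ∑ t ∈ Finset.range k,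
      ∑ f : Fin t → S, contProb M h0 f • sqMoment M hs (List.ofFn f) := by
  ext a b
  simp [modelMoment, Matrix.sum_apply]

lemma dotProduct_unifMoment_mulVec {S ι : Type*} [Fintype S] [Fintype ι]
    (M : List S → S → ℝ) (hs : ι → List S) (k : ℕ) (u : ι → ℝ) :
    u ⬝ᵥ (unifMoment M hs k *ᵥ u) = (1 / (k : ℝ)) * ∑ t ∈ Finset.range k,
      ((1 : ℝ) / (Fintype.card S : ℝ) ^ t) * ∑ f : Fin t → S,
        ∑ z, (∑ i, u i * nextLogit M (hs i ++ List.ofFn f) z) ^ 2 := by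
  simp only [unifMoment_eq_sum, Matrix.smul_mulVec, Matrix.sum_mulVec, dotProduct_smul,
    dotProduct_sum, dotProduct_sqMoment_mulVec, smul_eq_mul]

lemma dotProduct_modelMoment_mulVec {S ι : Type*} [Fintype S] [Fintype ι]
    (M : List S → S → ℝ) (hs : ι → List S) (h0 : List S) (k : ℕ) (u : ι → ℝ) :
    u ⬝ᵥ (modelMoment M hs h0 k *ᵥ u) = (1 / (k : ℝ)) * ∑ t ∈ Finset.range k,
      ∑ f : Fin t → S, contProb M h0 f *
        ∑ z, (∑ i, u i * nextLogit M (hs i ++ List.ofFn f) z) ^ 2 := by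
  simp only [modelMoment_eq_sum, Matrix.smul_mulVec, Matrix.sum_mulVec, dotProduct_smul,
    dotProduct_sum, dotProduct_sqMoment_mulVec, smul_eq_mul]

/-- Jensen's inequality for the square root of an average of `k` expectations. -/
lemma sum_expectation_sqrt_le {ι : ℕ → Type*} [∀ t, Fintype (ι t)] (k : ℕ)
    (p E : ∀ t, ι t → ℝ) (hp : ∀ t i, 0 ≤ p t i) (hp1 : ∀ t, ∑ i, p t i = 1)
    (hE : ∀ t i, 0 ≤ E t i) :
    ∑ t ∈ Finset.range k, ∑ i, p t i * Real.sqrt (E t i)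
      ≤ k * Real.sqrt ((1 / (k : ℝ)) * ∑ t ∈ Finset.range k, ∑ i, p t i * E t i) := by
  rcases Nat.eq_zero_or_pos k with rfl | hk
  · simp
  have hk' : (0 : ℝ) < k := by exact_mod_cast hk
  have hstep (t : ℕ) : (∑ i, p t i * Real.sqrt (E t i)) ^ 2 ≤ ∑ i, p t i * E t i := by
    have := Real.pow_arith_mean_le_arith_mean_pow Finset.univ (p t)
      (fun i => Real.sqrt (E t i)) (fun i _ => hp t i) (hp1 t) (fun i _ => Real.sqrt_nonneg _) 2
    simpa [Real.sq_sqrt (hE t _)] using this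
  have hsq : (∑ t ∈ Finset.range k, ∑ i, p t i * Real.sqrt (E t i)) ^ 2
      ≤ k * ∑ t ∈ Finset.range k, ∑ i, p t i * E t i := by
    refine (sq_sum_le_card_mul_sum_sq (s := Finset.range k)).trans ?_
    rw [Finset.card_range]
    gcongr with t
    exact hstep t
  have hrw : (k : ℝ) * Real.sqrt ((1 / (k : ℝ)) * ∑ t ∈ Finset.range k, ∑ i, p t i * E t i)
      = Real.sqrt (k * ∑ t ∈ Finset.range k, ∑ i, p t i * E t i) := by
    rw [← Real.sqrt_sq hk'.le, ← Real.sqrt_mul (sq_nonneg _), Real.sqrt_sq hk'.le]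
    congr 1
    field_simp
  rw [hrw]
  exact Real.le_sqrt_of_sq_le hsq

/-- LinGen generalization bound: under the matrix-coverage condition
`E_{P₂}[L L ᵀ] ⪯ α E_{P₁}[L Lᵀ] + γ I` over the histories `H₀ = {h₀} ∪ H` and the
regression-error bound `E_{P₁}[‖L_M({h₀},{f}) − vᵀ L_M(H,{f})‖²] ≤ Δ`, the KL
divergence from the true distribution of length-`k` continuations of `h₀` to the
`LinGen(v, H, k)` distribution is at most `2k √(αΔ + γ(1 + ‖v‖²))`. -/
theorem stmt_14 {S : Type*} [Fintype S] [DecidableEq S] (n k : ℕ)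
    (M : List S → S → ℝ) (hfull : ∀ y z, 0 < M y z) (hsum : ∀ y, ∑ z, M y z = 1)
    (h0 : List S) (hs : Fin n → List S) (α γ : ℝ) (hα : 0 ≤ α) (hγ : 0 ≤ γ)
    (hcov : (α • unifMoment M (Fin.cons h0 hs) k
        + γ • (1 : Matrix (Fin (n + 1)) (Fin (n + 1)) ℝ)
        - modelMoment M (Fin.cons h0 hs) h0 k).PosSemidef)
    (v : Fin n → ℝ) (Δ : ℝ)
    (hreg : (1 / (k : ℝ)) * ∑ t ∈ Finset.range k,
        ((1 : ℝ) / (Fintype.card S : ℝ) ^ t) * ∑ f : Fin t → S, ∑ z : S,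
          (nextLogit M (h0 ++ List.ofFn f) z
            - ∑ i, v i * nextLogit M (hs i ++ List.ofFn f) z) ^ 2 ≤ Δ) :
    klSeq k (truthProb M h0 k) (lingenProb M hs v k)
      ≤ 2 * k * Real.sqrt (α * Δ + γ * (1 + ∑ i, (v i) ^ 2)) := by
  set E : List S → ℝ := fun f => ∑ z, (nextLogit M (h0 ++ f) z
    - ∑ i, v i * nextLogit M (hs i ++ f) z) ^ 2 with hEdef
  have hE (f : List S) : 0 ≤ E f := Finset.sum_nonneg fun _ _ => sq_nonneg _
  let u : Fin (n + 1) → ℝ := Fin.cons 1 (-v)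
  have hu (f : List S) : ∑ z, (∑ i, u i *
      nextLogit M ((Fin.cons h0 hs : Fin (n + 1) → List S) i ++ f) z) ^ 2 = E f := by
    refine Finset.sum_congr rfl fun z _ => ?_
    simp [u, Fin.sum_univ_succ, sub_eq_add_neg]
  have huu : u ⬝ᵥ u = 1 + ∑ i, (v i) ^ 2 := by
    simp [u, dotProduct, Fin.sum_univ_succ, sq]
  have hmodel : (1 / (k : ℝ)) * ∑ t ∈ Finset.range k, ∑ f : Fin t → S,
      contProb M h0 f * E (List.ofFn f) ≤ α * Δ + γ * (1 + ∑ i, (v i) ^ 2) := by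
    have hpsd := hcov.dotProduct_mulVec_nonneg u
    simp only [star_trivial, Matrix.sub_mulVec, Matrix.add_mulVec, Matrix.smul_mulVec,
      Matrix.one_mulVec, dotProduct_sub, dotProduct_add, dotProduct_smul, smul_eq_mul,
      dotProduct_unifMoment_mulVec, dotProduct_modelMoment_mulVec, hu, huu] at hpsd
    have := mul_le_mul_of_nonneg_left hreg hα
    linarith
  have hlog (w : Fin k → S) : Real.log (truthProb M h0 k w / lingenProb M hs v k w)
      ≤ ∑ t : Fin k, 2 * Real.sqrt (E ((List.ofFn w).take t)) := by
    have hq (b : S → ℝ) (z : S) : 0 < softmaxF b z :=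
      div_pos (Real.exp_pos _) (Finset.sum_pos (fun _ _ => Real.exp_pos _) ⟨z, by simp⟩)
    rw [truthProb, lingenProb, ← Finset.prod_div_distrib,
      Real.log_prod fun t _ => (div_pos (hfull _ _) (hq _ _)).ne']
    refine Finset.sum_le_sum fun t _ => ?_
    refine log_div_softmaxF_le M _ (hfull _) (hsum _) _ _ (fun z => ?_) _
    refine Real.abs_le_sqrt ?_
    rw [hEdef]
    exact Finset.single_le_sum (f := fun z => (nextLogit M (h0 ++ (List.ofFn w).take t) z
      - ∑ i, v i * nextLogit M (hs i ++ (List.ofFn w).take t) z) ^ 2)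
      (fun _ _ => sq_nonneg _) (Finset.mem_univ z)
  have hnn : ∀ y z, 0 ≤ M y z := fun y z => (hfull y z).le
  calc klSeq k (truthProb M h0 k) (lingenProb M hs v k)
      ≤ ∑ w : Fin k → S, contProb M h0 w
          * ∑ t : Fin k, 2 * Real.sqrt (E ((List.ofFn w).take t)) :=
        Finset.sum_le_sum fun w _ =>
          mul_le_mul_of_nonneg_left (hlog w) (contProb_nonneg hnn h0 w)
    _ = ∑ t : Fin k, ∑ w : Fin k → S, contProb M h0 w
          * (2 * Real.sqrt (E ((List.ofFn w).take t))) := by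
        simp only [Finset.mul_sum]
        exact Finset.sum_comm
    _ = ∑ t : Fin k, ∑ f : Fin t → S, contProb M h0 f * (2 * Real.sqrt (E (List.ofFn f))) :=
        Finset.sum_congr rfl fun t _ =>
          sum_contProb_mul_take hsum h0 (fun f => 2 * Real.sqrt (E f)) t.2.le
    _ = 2 * ∑ t ∈ Finset.range k, ∑ f : Fin t → S,
          contProb M h0 f * Real.sqrt (E (List.ofFn f)) := by
        rw [Fin.sum_univ_eq_sum_range (fun t => ∑ f : Fin t → S,
          contProb M h0 f * (2 * Real.sqrt (E (List.ofFn f)))) k]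
        simp only [Finset.mul_sum, mul_left_comm]
    _ ≤ 2 * (k * Real.sqrt ((1 / (k : ℝ)) * ∑ t ∈ Finset.range k, ∑ f : Fin t → S,
          contProb M h0 f * E (List.ofFn f))) := by
        gcongr
        exact sum_expectation_sqrt_le k (fun t (f : Fin t → S) => contProb M h0 f)
          (fun t f => E (List.ofFn f)) (fun t f => contProb_nonneg hnn h0 f)
          (fun t => sum_contProb hsum h0 t) (fun t f => hE _)
    _ ≤ 2 * k * Real.sqrt (α * Δ + γ * (1 + ∑ i, (v i) ^ 2)) := by
        rw [← mul_assoc]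
        gcongr
end

section
/- Let P = (p_1,…,p_s) and Q = (q_1,…,q_s) be probability distributions on s elements with all p_i > 0, and suppose −log p_i ≤ C for all i ∈ [s] (equivalently p_i ≥ e^{−C}). Then KL(Q ‖ P) ≤ (1 + C) · sqrt(2 · KL(P ‖ Q)). -/
/-- The pointwise comparison of the relative entropy with the squared Hellinger distance. -/
theorem sq_sqrt_sub_sqrt_add_sub_le_mul_log_div {x y : ℝ} (hx : 0 < x) (hy : 0 < y) :
    (√x - √y) ^ 2 + (x - y) ≤ x * Real.log (x / y) := by
  have ha := Real.sqrt_pos.2 hx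
  have hb := Real.sqrt_pos.2 hy
  have hxa := Real.sq_sqrt hx.le
  have hyb := Real.sq_sqrt hy.le
  have hlog : Real.log (x / y) = -(2 * Real.log (√y / √x)) := by
    rw [Real.log_div hx.ne' hy.ne', Real.log_div hb.ne' ha.ne', Real.log_sqrt hx.le,
      Real.log_sqrt hy.le]
    ring
  have hmul : x * (√y / √x) = √x * √y := by
    rw [← mul_div_assoc, div_eq_iff ha.ne']
    linear_combination (-√y) * hxa
  have hle := mul_le_mul_of_nonneg_left
    (Real.log_le_sub_one_of_pos (div_pos hb ha)) hx.le
  rw [hlog]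
  nlinarith

/-- A form of Pinsker's inequality with constant `4` in place of `2`. -/
theorem sq_sum_abs_sub_le_four_mul_sum_mul_log_div {ι : Type*} [Fintype ι] {p q : ι → ℝ}
    (hp : ∀ i, 0 < p i) (hq : ∀ i, 0 < q i) (hps : ∑ i, p i = 1) (hqs : ∑ i, q i = 1) :
    (∑ i, |p i - q i|) ^ 2 ≤ 4 * ∑ i, p i * Real.log (p i / q i) := by
  have habs (i : ι) : |p i - q i| = |√(p i) - √(q i)| * (√(p i) + √(q i)) := by
    rw [← abs_of_nonneg (by positivity : 0 ≤ √(p i) + √(q i)), ← abs_mul]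
    congr 1
    linear_combination -Real.sq_sqrt (hp i).le + Real.sq_sqrt (hq i).le
  have hhell : ∑ i, (√(p i) - √(q i)) ^ 2 ≤ ∑ i, p i * Real.log (p i / q i) := by
    have h := Finset.sum_le_sum fun i (_ : i ∈ Finset.univ) ↦
      sq_sqrt_sub_sqrt_add_sub_le_mul_log_div (hp i) (hq i)
    simpa [Finset.sum_add_distrib, Finset.sum_sub_distrib, hps, hqs] using h
  have hadd : ∑ i, (√(p i) + √(q i)) ^ 2 ≤ 4 := by
    have h : ∑ i, (√(p i) + √(q i)) ^ 2 ≤ ∑ i, (2 * p i + 2 * q i) :=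
      Finset.sum_le_sum fun i _ ↦ by
        nlinarith [sq_nonneg (√(p i) - √(q i)), Real.sq_sqrt (hp i).le, Real.sq_sqrt (hq i).le]
    rw [Finset.sum_add_distrib, ← Finset.mul_sum, ← Finset.mul_sum, hps, hqs] at h
    linarith
  calc (∑ i, |p i - q i|) ^ 2
      ≤ (∑ i, (√(p i) - √(q i)) ^ 2) * ∑ i, (√(p i) + √(q i)) ^ 2 := by
        simp only [habs]
        simpa only [sq_abs] using Finset.sum_mul_sq_le_sq_mul_sq Finset.univ
          (fun i ↦ |√(p i) - √(q i)|) (fun i ↦ √(p i) + √(q i))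
    _ ≤ (∑ i, (√(p i) - √(q i)) ^ 2) * 4 := by gcongr
    _ ≤ 4 * ∑ i, p i * Real.log (p i / q i) := by linarith

theorem mul_log_div_le_one_add_mul_posPart {x y C : ℝ} (hx : 0 < x) (hy : 0 < y)
    (hy1 : y ≤ 1) (hC : -Real.log x ≤ C) :
    y * Real.log (y / x) ≤ (1 + C) * ((|x - y| + (y - x)) / 2) := by
  rcases le_total y x with hyx | hxy
  · have hlog : Real.log (y / x) ≤ 0 :=
      Real.log_nonpos (by positivity) ((div_le_one hx).2 hyx)
    rw [abs_of_nonneg (sub_nonneg.2 hyx)]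
    nlinarith
  · have hlog : Real.log (y / x) ≤ C := by
      rw [Real.log_div hy.ne' hx.ne']
      linarith [Real.log_nonpos hy.le hy1]
    have hmul : x * Real.log (y / x) ≤ y - x := by
      have h := mul_le_mul_of_nonneg_left (Real.log_le_sub_one_of_pos (div_pos hy hx)) hx.le
      rwa [mul_sub, mul_div_cancel₀ y hx.ne', mul_one] at h
    rw [abs_of_nonpos (sub_nonpos.2 hxy)]
    nlinarith [mul_le_mul_of_nonneg_left hlog (sub_nonneg.2 hxy)]

/-- flipping the KL divergence: if `P = (p₁, …, p_s)` and
`Q = (q₁, …, q_s)` are probability distributions with full support and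
`−log pᵢ ≤ C` for all `i`, then `KL(Q ‖ P) ≤ (1 + C) √(2 KL(P ‖ Q))`. -/
theorem stmt_18 (s : ℕ) (p q : Fin s → ℝ)
    (hp : ∀ i, 0 < p i) (hq : ∀ i, 0 < q i)
    (hps : ∑ i, p i = 1) (hqs : ∑ i, q i = 1)
    (C : ℝ) (hC : ∀ i, -Real.log (p i) ≤ C) :
    ∑ i, q i * Real.log (q i / p i)
      ≤ (1 + C) * Real.sqrt (2 * ∑ i, p i * Real.log (p i / q i)) := by
  have hp1 (i : Fin s) : p i ≤ 1 :=
    hps ▸ Finset.single_le_sum (fun j _ ↦ (hp j).le) (Finset.mem_univ i)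
  have hq1 (i : Fin s) : q i ≤ 1 :=
    hqs ▸ Finset.single_le_sum (fun j _ ↦ (hq j).le) (Finset.mem_univ i)
  have hC0 : 0 ≤ C := by
    obtain ⟨i, -⟩ := Finset.nonempty_of_sum_ne_zero (hps.trans_ne one_ne_zero)
    linarith [hC i, Real.log_nonpos (hp i).le (hp1 i)]
  have hpinsker := sq_sum_abs_sub_le_four_mul_sum_mul_log_div hp hq hps hqs
  calc ∑ i, q i * Real.log (q i / p i)
      ≤ ∑ i, (1 + C) * ((|p i - q i| + (q i - p i)) / 2) :=
        Finset.sum_le_sum fun i _ ↦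
          mul_log_div_le_one_add_mul_posPart (hp i) (hq i) (hq1 i) (hC i)
    _ = (1 + C) * ((∑ i, |p i - q i|) / 2) := by
        rw [← Finset.mul_sum, ← Finset.sum_div, Finset.sum_add_distrib, Finset.sum_sub_distrib,
          hps, hqs, sub_self, add_zero]
    _ ≤ (1 + C) * √(2 * ∑ i, p i * Real.log (p i / q i)) := by
        gcongr
        apply Real.le_sqrt_of_sq_le
        nlinarith [sq_nonneg (∑ i, |p i - q i|)]
end
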